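/- For every g ∈ GL₂(ℚ_p) and every f ∈ B(α), the function g·f belongs to B(α), and the map f ↦ g·f is a continuous linear automorphism of the Banach space B(α); in other words, the given formula defines an action of GL₂(ℚ_p) on B(α) by continuous automorphisms. -/

import Mathlib

open Filter Topology Classical

noncomputable section

namespace Paper

variable (p : ℕ) [Fact p.Prime]
variable (L : Type) [NontriviallyNormedField L] [NormedAlgebra ℚ_[p] L]

/-- The canonical embedding `ℚ_p → L`. -/
noncomputable def iotaL : ℚ_[p] → L := algebraMap ℚ_[p] L

/-- The binomial coefficient `binom(z, n) = z(z-1)⋯(z-n+1)/n!` of a `p`-adic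
integer, computed in `ℚ_p`. -/
noncomputable def binomQ (z : ℤ_[p]) (n : ℕ) : ℚ_[p] :=
  (∏ i ∈ Finset.range n, ((z : ℚ_[p]) - (i : ℚ_[p]))) / (n.factorial : ℚ_[p])

/-- The Mahler coefficients `a_n(f) = ∑_{i=0}^n (-1)^i binom(n,i) f(n-i)`. -/
noncomputable def mahlerCoeff (f : ℤ_[p] → L) (n : ℕ) : L :=
  ∑ i ∈ Finset.range (n + 1), (-1 : L) ^ i * (n.choose i : L) * f (((n - i : ℕ) : ℤ_[p]))

/-- `f : ℤ_p → L` is of class `C^r` : the scaled Mahler coefficients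
`n^r a_n(f)` tend to `0`, and `f` is the sum of its Mahler expansion. -/
def IsCr (r : ℝ) (f : ℤ_[p] → L) : Prop :=
  Tendsto (fun n : ℕ => (n : ℝ) ^ r * ‖mahlerCoeff p L f n‖) atTop (nhds 0) ∧
  ∀ z : ℤ_[p], HasSum (fun n : ℕ => mahlerCoeff p L f n * iotaL p L (binomQ p z n)) (f z)

/-- The norm `‖f‖_r = sup_n (n+1)^r ‖a_n(f)‖` on `C^r(ℤ_p, L)`. -/
noncomputable def crNorm (r : ℝ) (f : ℤ_[p] → L) : ℝ :=
  ⨆ n : ℕ, ((n : ℝ) + 1) ^ r * ‖mahlerCoeff p L f n‖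

/-- A continuous (= bounded) linear functional on `C^r(ℤ_p, L)`, i.e. a tempered
distribution of order `r`. -/
structure CrDual (r : ℝ) where
  toFun : (ℤ_[p] → L) → L
  map_add' : ∀ f g : ℤ_[p] → L, IsCr p L r f → IsCr p L r g →
    toFun (f + g) = toFun f + toFun g
  map_smul' : ∀ (c : L) (f : ℤ_[p] → L), IsCr p L r f → toFun (c • f) = c * toFun f
  bound' : ∃ C : ℝ, ∀ f : ℤ_[p] → L, IsCr p L r f → ‖toFun f‖ ≤ C * crNorm p L r f

/-- The function `z ↦ 1_{a + pⁿℤ_p}(z) (z - a)^j`. -/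
noncomputable def indPoly (a : ℤ_[p]) (n : ℕ) (j : ℕ) : ℤ_[p] → L := fun z =>
  if ‖z - a‖ ≤ (p : ℝ) ^ (-(n : ℤ)) then (iotaL p L ((z : ℚ_[p]) - (a : ℚ_[p]))) ^ j else 0

/-- The norm `‖μ‖_{r,d} = sup_{a, 0 ≤ j ≤ d, n} p^{n(j-r)} ‖∫_{a+pⁿℤ_p} (z-a)^j dμ‖`. -/
noncomputable def dualNormRD (r : ℝ) (d : ℕ) (μ : CrDual p L r) : ℝ :=
  ⨆ (a : ℤ_[p]) (j : Fin (d + 1)) (n : ℕ),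
    (p : ℝ) ^ ((n : ℝ) * (((j : ℕ) : ℝ) - r)) * ‖μ.toFun (indPoly p L a n j)‖

/-- `f : ℤ_p → L` is locally polynomial of local degree at most `d`. -/
def IsLocPoly (d : ℕ) (f : ℤ_[p] → L) : Prop :=
  ∃ n : ℕ, ∀ a : ℤ_[p], ∃ P : Polynomial L, P.natDegree ≤ d ∧
    ∀ z : ℤ_[p], ‖z - a‖ ≤ (p : ℝ) ^ (-(n : ℤ)) → f z = Polynomial.eval (iotaL p L (z : ℚ_[p])) P

/-- A linear functional on `Pol^d(ℤ_p, L)`. -/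
structure PolDual (d : ℕ) where
  toFun : (ℤ_[p] → L) → L
  map_add' : ∀ f g : ℤ_[p] → L, IsLocPoly p L d f → IsLocPoly p L d g →
    toFun (f + g) = toFun f + toFun g
  map_smul' : ∀ (c : L) (f : ℤ_[p] → L), IsLocPoly p L d f → toFun (c • f) = c * toFun f

/-- The valuation `val(x) = -log_p ‖x‖` on `L`, normalized by `val(p) = 1`. -/
noncomputable def valL (x : L) : ℝ := -Real.logb p ‖x‖

/-- `g : ℤ_p → L` is a class-`C^{val α}` extension of
`z ↦ (αp/β)^{val z} z^{k-2} f(1/z)` from `ℤ_p ∖ {0}` to `ℤ_p`. -/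
def Ext2 (k : ℕ) (α β : L) (f : ℚ_[p] → L) (g : ℤ_[p] → L) : Prop :=
  IsCr p L (valL p L α) g ∧ ∀ z : ℤ_[p], z ≠ 0 →
    g z = (α * (p : L) / β) ^ ((z : ℚ_[p]).valuation) *
      (iotaL p L (z : ℚ_[p])) ^ (k - 2) * f (((z : ℚ_[p]))⁻¹)

/-- Membership in the Banach space `B(α)`. -/
def MemB (k : ℕ) (α β : L) (f : ℚ_[p] → L) : Prop :=
  IsCr p L (valL p L α) (fun z : ℤ_[p] => f ((p : ℚ_[p]) * (z : ℚ_[p]))) ∧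
  ∃ g : ℤ_[p] → L, Ext2 p L k α β f g

/-- The extension `f₂` of `z ↦ (αp/β)^{val z} z^{k-2} f(1/z)` to `ℤ_p`
(it is unique when it exists). -/
noncomputable def ext2 (k : ℕ) (α β : L) (f : ℚ_[p] → L) : ℤ_[p] → L :=
  if h : ∃ g : ℤ_[p] → L, Ext2 p L k α β f g then h.choose else 0

/-- The norm `‖f‖ = max(‖f₁‖_{val α}, ‖f₂‖_{val α})` on `B(α)`. -/
noncomputable def bNorm (k : ℕ) (α β : L) (f : ℚ_[p] → L) : ℝ :=
  max (crNorm p L (valL p L α) (fun z : ℤ_[p] => f ((p : ℚ_[p]) * (z : ℚ_[p]))))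
      (crNorm p L (valL p L α) (ext2 p L k α β f))

/-- Determinant of a 2×2 matrix. -/
noncomputable def det2 (m : Matrix (Fin 2) (Fin 2) ℚ_[p]) : ℚ_[p] :=
  m 0 0 * m 1 1 - m 0 1 * m 1 0

/-- The action of `g = (a b; c d) ∈ GL₂(ℚ_p)` on `B(α)`:
`(g·f)(z) = α^{-val(ad-bc)} (αp/β)^{val(-cz+a)} (-cz+a)^{k-2} f((dz-b)/(-cz+a))`,
the value at the pole `-cz+a = 0` being the one prescribed by the extension `f₂`. -/
noncomputable def gAct (k : ℕ) (α β : L) (m : Matrix (Fin 2) (Fin 2) ℚ_[p])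
    (f : ℚ_[p] → L) : ℚ_[p] → L := fun z =>
  if -(m 1 0) * z + m 0 0 = 0 then
    α ^ (-(det2 p m).valuation) * (α * (p : L) / β) ^ ((det2 p m / m 1 0).valuation) *
      (iotaL p L (det2 p m / m 1 0)) ^ (k - 2) * ext2 p L k α β f 0
  else
    α ^ (-(det2 p m).valuation) * (α * (p : L) / β) ^ ((-(m 1 0) * z + m 0 0).valuation) *
      (iotaL p L (-(m 1 0) * z + m 0 0)) ^ (k - 2) *
      f ((m 1 1 * z - m 0 1) / (-(m 1 0) * z + m 0 0))

/-- The monomial function `z ↦ z^j` on `ℚ_p`. -/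
noncomputable def monomialFun (j : ℕ) : ℚ_[p] → L := fun z => (iotaL p L z) ^ j

/-- The function `z ↦ (αp/β)^{val(z-a)} (z-a)^{k-2-j}` (extended by `0` at `z = a`). -/
noncomputable def specFun (k : ℕ) (α β : L) (a : ℚ_[p]) (j : ℕ) : ℚ_[p] → L := fun z =>
  if z = a then 0 else
    (α * (p : L) / β) ^ ((z - a).valuation) * (iotaL p L (z - a)) ^ (k - 2 - j)

/-- The generators of `L(α)` : the functions `z^j` and
`(αp/β)^{val(z-a)}(z-a)^{k-2-j}` for `0 ≤ j < val(α)` and `a ∈ ℚ_p`. -/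
def lGen (k : ℕ) (α β : L) : Set (ℚ_[p] → L) :=
  {f | ∃ j : ℕ, (j : ℝ) < valL p L α ∧
    (f = monomialFun p L j ∨ ∃ a : ℚ_[p], f = specFun p L k α β a j)}

/-- Membership in `L(α)`, the closure in `B(α)` of the span of the special
functions. -/
def MemLalpha (k : ℕ) (α β : L) (f : ℚ_[p] → L) : Prop :=
  MemB p L k α β f ∧ ∀ ε : ℝ, 0 < ε →
    ∃ g ∈ Submodule.span L (lGen p L k α β), bNorm p L k α β (f - g) < ε

/-- The quotient (semi)norm on `Π(V) = B(α)/L(α)`. -/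
noncomputable def qNorm (k : ℕ) (α β : L) (f : ℚ_[p] → L) : ℝ :=
  sInf {x : ℝ | ∃ g : ℚ_[p] → L, MemLalpha p L k α β g ∧ x = bNorm p L k α β (f - g)}

/-- `h : ℚ_p → L` is locally constant. -/
def LocConst (h : ℚ_[p] → L) : Prop :=
  ∀ x : ℚ_[p], ∃ n : ℕ, ∀ y : ℚ_[p], ‖y - x‖ ≤ (p : ℝ) ^ (-(n : ℤ)) → h y = h x

/-- `h` belongs to the smooth induced representation: `h` is locally constant and
`z ↦ (αp/β)^{val z} h(1/z)` extends to a locally constant function on `ℚ_p`. -/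
def IndCond (α β : L) (h : ℚ_[p] → L) : Prop :=
  LocConst p L h ∧ ∃ h' : ℚ_[p] → L, LocConst p L h' ∧
    ∀ z : ℚ_[p], z ≠ 0 → h' z = (α * (p : L) / β) ^ z.valuation * h z⁻¹

/-- The generators `z ↦ P(z) h(z)` of the locally algebraic representation `π(α)`. -/
def piGen (k : ℕ) (α β : L) : Set (ℚ_[p] → L) :=
  {f | ∃ (P : Polynomial L) (h : ℚ_[p] → L), P.natDegree ≤ k - 2 ∧ IndCond p L α β h ∧
    f = fun z => Polynomial.eval (iotaL p L z) P * h z}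

/-- The locally algebraic representation `π(α)`, as a subspace of functions
`ℚ_p → L`. -/
noncomputable def piRep (k : ℕ) (α β : L) : Submodule L (ℚ_[p] → L) :=
  Submodule.span L (piGen p L k α β)

/-- The standing hypotheses on `(k, α, β)` coming from an absolutely irreducible,
`φ`-semisimple crystalline representation: `k ≥ 2`, `α ≠ β`,
`0 < val(β) ≤ val(α)` and `val(α) + val(β) = k - 1`. -/
def Hyps (k : ℕ) (α β : L) : Prop :=
  2 ≤ k ∧ α ≠ β ∧ 0 < valL p L α ∧ 0 < valL p L β ∧
    valL p L α + valL p L β = (k : ℝ) - 1 ∧ valL p L β ≤ valL p L α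

/-- `Λ` is a `GL₂(ℚ_p)`-stable `𝒪_L`-lattice in `π(α)`: an `𝒪_L`-submodule of
`π(α)` generating it over `L`, containing no `L`-line and stable by the action. -/
def IsLatticeStable (k : ℕ) (α β : L) (Λ : Set (ℚ_[p] → L)) : Prop :=
  (∀ f ∈ Λ, f ∈ piRep p L k α β) ∧ ((0 : ℚ_[p] → L) ∈ Λ) ∧
  (∀ f ∈ Λ, ∀ g ∈ Λ, f + g ∈ Λ) ∧
  (∀ c : L, ‖c‖ ≤ 1 → ∀ f ∈ Λ, c • f ∈ Λ) ∧
  (∀ f ∈ piRep p L k α β, ∃ c : L, c ≠ 0 ∧ c • f ∈ Λ) ∧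
  (∀ f, f ∈ piRep p L k α β → f ≠ 0 → ¬ ∀ c : L, c • f ∈ Λ) ∧
  (∀ m : Matrix (Fin 2) (Fin 2) ℚ_[p], det2 p m ≠ 0 → ∀ f ∈ Λ, gAct p L k α β m f ∈ Λ)

set_option linter.unusedSectionVars false

section Differences

open Polynomial

variable {K : Type*} [NormedField K]

/-- A sequence whose `i`-th differences are divisible by `i!`. -/
def DivDiff (e : ℕ → K) : Prop := ∀ i z, ‖(fwdDiff 1)^[i] e z‖ ≤ ‖(i.factorial : K)‖

lemma fwdDiff_iter_mul (f g : ℕ → K) (n z : ℕ) :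
    (fwdDiff 1)^[n] (fun u => f u * g u) z = ∑ ij ∈ Finset.HasAntidiagonal.antidiagonal n,
      (n.choose ij.1 : K) * ((fwdDiff 1)^[ij.1] f z * (fwdDiff 1)^[ij.2] g (z + ij.1)) := by
  induction n generalizing f g with
  | zero => simp
  | succ n ih =>
    rw [Finset.sum_antidiagonal_choose_succ_mul
      (fun i j => (fwdDiff 1)^[i] f z * (fwdDiff 1)^[j] g (z + i)), Function.iterate_succ_apply]
    have h : fwdDiff 1 (fun u => f u * g u)
        = (fun u => f u * fwdDiff 1 g u) + fun u => fwdDiff 1 f u * g (u + 1) := by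
      funext u; simp only [fwdDiff, Pi.add_apply]; ring
    rw [h, fwdDiff_iter_add, Pi.add_apply, ih, ih (fwdDiff 1 f) (fun u => g (u + 1))]
    congr 1
    refine Finset.sum_congr rfl fun ij hij => ?_
    rw [Finset.HasAntidiagonal.mem_antidiagonal] at hij
    rw [fwdDiff_iter_comp_add, Function.iterate_succ_apply, ← Nat.choose_symm_of_eq_add hij.symm,
      add_assoc]

lemma fwdDiff_iter_const_succ (c : K) (n z : ℕ) : (fwdDiff 1)^[n + 1] (fun _ : ℕ => c) z = 0 := by
  rw [Function.iterate_succ_apply, fwdDiff_const]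
  have h := map_zero (fwdDiff_aux.fwdDiffₗ ℕ K 1 ^ n)
  rw [fwdDiff_aux.coe_fwdDiffₗ_pow] at h
  exact congrFun h z

namespace DivDiff

lemma const {c : K} (hc : ‖c‖ ≤ 1) : DivDiff fun _ => c := by
  intro n z
  cases n with
  | zero => simpa using hc
  | succ n => rw [fwdDiff_iter_const_succ]; simp

variable [IsUltrametricDist K]

lemma mul {f g : ℕ → K} (hf : DivDiff f) (hg : DivDiff g) : DivDiff fun u => f u * g u := by
  intro n z
  rw [fwdDiff_iter_mul]
  refine IsUltrametricDist.norm_sum_le_of_forall_le_of_nonneg (norm_nonneg _) fun ij hij => ?_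
  rw [Finset.HasAntidiagonal.mem_antidiagonal] at hij
  have h := Nat.choose_mul_factorial_mul_factorial (n := n) (k := ij.1) (by lia)
  rw [show n - ij.1 = ij.2 by lia] at h
  rw [← h]
  push_cast
  simp only [norm_mul, mul_assoc]
  gcongr
  · exact hf _ _
  · exact hg _ _

lemma add {f g : ℕ → K} (hf : DivDiff f) (hg : DivDiff g) : DivDiff fun u => f u + g u := by
  intro n z
  have : (fun u => f u + g u) = f + g := rfl
  rw [this, fwdDiff_iter_add]
  exact (IsUltrametricDist.norm_add_le_max _ _).trans (max_le (hf _ _) (hg _ _))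

lemma natCast : DivDiff fun u => (u : K) := by
  intro n z
  cases n with
  | zero => simpa using IsUltrametricDist.norm_natCast_le_one K z
  | succ n =>
    have : fwdDiff 1 (fun u : ℕ => (u : K)) = fun _ => 1 := by funext u; simp [fwdDiff]
    rw [Function.iterate_succ_apply, this]
    cases n with
    | zero => simp
    | succ n => rw [fwdDiff_iter_const_succ]; simp

lemma sum {ι : Type*} {s : Finset ι} {f : ι → ℕ → K} (hf : ∀ i ∈ s, DivDiff (f i)) :
    DivDiff fun u => ∑ i ∈ s, f i u := by
  induction s using Finset.cons_induction with
  | empty => simpa using const (K := K) (c := 0) (by simp)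
  | cons i s hi ih =>
    simp only [Finset.sum_cons]
    exact (hf i (by simp)).add (ih fun j hj => hf j (by simp [hj]))

lemma prod {ι : Type*} {s : Finset ι} {f : ι → ℕ → K} (hf : ∀ i ∈ s, DivDiff (f i)) :
    DivDiff fun u => ∏ i ∈ s, f i u := by
  induction s using Finset.cons_induction with
  | empty => simpa using const (K := K) (c := 1) (by simp)
  | cons i s hi ih =>
    simp only [Finset.prod_cons]
    exact (hf i (by simp)).mul (ih fun j hj => hf j (by simp [hj]))

lemma pow {f : ℕ → K} (hf : DivDiff f) (n : ℕ) : DivDiff fun u => f u ^ n := by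
  simpa using prod (s := Finset.range n) fun _ _ => hf

lemma affine {s t : K} (hs : ‖s‖ ≤ 1) (ht : ‖t‖ ≤ 1) : DivDiff fun u => s + t * u :=
  (const hs).add ((const ht).mul natCast)

end DivDiff

lemma fwdDiff_iter_inv_affine {s t : K} (h : ∀ u : ℕ, s + t * u ≠ 0) (n u : ℕ) :
    (fwdDiff 1)^[n] (fun u : ℕ => (s + t * u)⁻¹) u
      = (-t) ^ n * n.factorial * ∏ j ∈ Finset.range (n + 1), (s + t * (u + j : ℕ))⁻¹ := by
  induction n generalizing u with
  | zero => simp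
  | succ n ih =>
    rw [Function.iterate_succ_apply', fwdDiff, ih, ih, Finset.prod_range_succ,
      Finset.prod_range_succ' _ (n + 1), Finset.prod_range_succ' _ n]
    have e : ∀ N, ∏ j ∈ Finset.range N, (s + t * ((u + (j + 1) : ℕ) : K))⁻¹ =
        ∏ j ∈ Finset.range N, (s + t * ((u + 1 + j : ℕ) : K))⁻¹ := fun N =>
      Finset.prod_congr rfl fun j _ => by rw [Nat.add_right_comm u 1 j, add_assoc]
    rw [e, e]
    rw [Finset.prod_range_succ (fun j => (s + t * ((u + 1 + j : ℕ) : K))⁻¹) n]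
    have h1 := h (u + 1 + n)
    have h2 := h (u + 0)
    rw [Nat.factorial_succ]
    push_cast at h1 h2 ⊢
    field_simp
    ring

lemma DivDiff.inv_affine {s t : K} (h : ∀ u : ℕ, ‖s + t * u‖ = 1) (ht : ‖t‖ ≤ 1) :
    DivDiff fun u => (s + t * u)⁻¹ := by
  intro n u
  rw [fwdDiff_iter_inv_affine fun u => norm_ne_zero_iff.mp (by simp [h])]
  simp only [norm_mul, norm_pow, norm_neg, norm_prod, norm_inv, h, inv_one, Finset.prod_const_one,
    mul_one]
  exact mul_le_of_le_one_left (norm_nonneg _) (pow_le_one₀ (norm_nonneg _) ht)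

variable [IsUltrametricDist K]

lemma norm_aeval_fwdDiff_le (P : ℤ[X]) {g : ℕ → K} {C : ℝ} (hg : ∀ z, ‖g z‖ ≤ C) (z : ℕ) :
    ‖aeval (fwdDiff_aux.fwdDiffₗ ℕ K 1) P g z‖ ≤ C := by
  have hC : 0 ≤ C := (norm_nonneg _).trans (hg 0)
  induction P using Polynomial.induction_on' generalizing z with
  | add P Q hP hQ =>
    rw [map_add, LinearMap.add_apply, Pi.add_apply]
    exact (IsUltrametricDist.norm_add_le_max _ _).trans (max_le (hP _) (hQ _))
  | monomial n c =>
    rw [aeval_monomial, Algebra.algebraMap_eq_smul_one, smul_mul_assoc, one_mul,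
      LinearMap.smul_apply, Pi.smul_apply, fwdDiff_aux.coe_fwdDiffₗ_pow, fwdDiff_iter_eq_sum_shift]
    have hz : ∀ (a : ℤ) (x : K), ‖x‖ ≤ C → ‖a • x‖ ≤ C := fun a x hx => by
      rw [zsmul_eq_mul, norm_mul]
      exact (mul_le_of_le_one_left (norm_nonneg _)
        (IsUltrametricDist.norm_intCast_le_one K a)).trans hx
    refine hz _ _ (IsUltrametricDist.norm_sum_le_of_forall_le_of_nonneg hC fun i _ => ?_)
    exact hz _ _ (hg _)

/-- Mahler coefficients of a locally divisible function decay like factorials. -/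
lemma norm_fwdDiff_iter_le_of_divDiff {q : ℕ} (hq : q.Prime)
    (hqK : ∀ j : ℕ, ‖(q : K)‖ ^ j ≤ ‖(j.factorial : K)‖) {e : ℕ → K} {h : ℕ}
    (he : ∀ z, DivDiff fun u => e (z + u * q ^ h)) (m z : ℕ) :
    ‖(fwdDiff 1)^[m] e z‖ ≤ ‖((m / q ^ h).factorial : K)‖ := by
  set Q := q ^ h
  set M := m / Q with hM
  set A := aeval (R := ℤ) (fwdDiff_aux.fwdDiffₗ ℕ K 1) with hA
  obtain ⟨r, hr⟩ := exists_add_pow_prime_pow_eq hq (X : ℤ[X]) 1 h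
  have hX : (X : ℤ[X]) ^ m = ∑ i ∈ Finset.range (M + 1),
      (((M.choose i * q ^ (M - i) : ℕ) : ℤ[X]) * ((X ^ (m % Q) * (-(X * r)) ^ (M - i)) *
        ((X + 1) ^ Q - 1) ^ i)) := by
    conv_lhs => rw [← Nat.mod_add_div m Q, pow_add, pow_mul]
    have h1 : (X : ℤ[X]) ^ Q = ((X + 1) ^ Q - 1) + (q : ℤ[X]) * (-(X * r)) := by
      rw [hr]; simp only [one_pow]; ring
    rw [h1, add_pow, Finset.mul_sum]
    refine Finset.sum_congr rfl fun i _ => ?_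
    push_cast
    rw [mul_pow]
    ring
  have hshift : A (X + 1) = fwdDiff_aux.shiftₗ ℕ K 1 := by
    rw [map_add, map_one, hA, aeval_X]; rfl
  have hstep : ∀ i w, ‖A (((X + 1) ^ Q - 1) ^ i) e w‖ ≤ ‖(i.factorial : K)‖ := by
    intro i w
    have h1 : A ((X + 1) ^ Q - 1) = fwdDiff_aux.fwdDiffₗ ℕ K Q := by
      rw [map_sub, map_pow, hshift, map_one]
      refine LinearMap.ext fun f => funext fun y => ?_
      rw [LinearMap.sub_apply, Pi.sub_apply, fwdDiff_aux.shiftₗ_pow_apply]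
      simp [fwdDiff]
    rw [map_pow, h1, fwdDiff_aux.coe_fwdDiffₗ_pow]
    convert he w i 0 using 2
    simp only [fwdDiff_iter_eq_sum_shift]
    simp
  have hpow : (fwdDiff 1)^[m] e z = A (X ^ m) e z := by
    rw [map_pow, hA, aeval_X, fwdDiff_aux.coe_fwdDiffₗ_pow]
  rw [hpow, hX, map_sum, LinearMap.sum_apply, Finset.sum_apply]
  refine IsUltrametricDist.norm_sum_le_of_forall_le_of_nonneg (norm_nonneg _) fun i hi => ?_
  have hi' : i ≤ M := by simpa [Nat.lt_succ_iff] using hi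
  rw [map_mul, map_natCast, map_mul, Module.End.mul_apply, Module.End.mul_apply,
    Module.End.natCast_apply, Pi.smul_apply, nsmul_eq_mul, norm_mul]
  refine (mul_le_mul_of_nonneg_left (norm_aeval_fwdDiff_le _ (hstep i) z) (norm_nonneg _)).trans ?_
  rw [← Nat.choose_mul_factorial_mul_factorial hi']
  push_cast
  simp only [norm_mul, norm_pow]
  have := hqK (M - i)
  calc _ = ‖(M.choose i : K)‖ * ‖(i.factorial : K)‖ * ‖(q : K)‖ ^ (M - i) := by ring
    _ ≤ _ := by gcongr

end Differences

section ClassCr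

variable {p L}

lemma norm_natCast_eq (n : ℕ) : ‖(n : L)‖ = ‖(n : ℚ_[p])‖ := by
  rw [← map_natCast (algebraMap ℚ_[p] L), norm_algebraMap']

lemma mahlerCoeff_eq (f : ℤ_[p] → L) (n : ℕ) :
    mahlerCoeff p L f n = (fwdDiff 1)^[n] f 0 := by
  rw [fwdDiff_iter_eq_sum_shift, mahlerCoeff, ← Finset.sum_range_reflect]
  refine Finset.sum_congr rfl fun i hi => ?_
  have hi' : i ≤ n := by simpa [Nat.lt_succ_iff] using hi
  have h1 : n + 1 - 1 - i = n - i := by lia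
  have h2 : n - (n - i) = i := by lia
  rw [h1, h2, Nat.choose_symm hi']
  simp [zsmul_eq_mul]

lemma mahlerCoeff_eq_nat (f : ℤ_[p] → L) (n : ℕ) :
    mahlerCoeff p L f n = (fwdDiff 1)^[n] (fun j : ℕ => f j) 0 := by
  rw [mahlerCoeff_eq, fwdDiff_iter_eq_sum_shift, fwdDiff_iter_eq_sum_shift]
  simp

lemma choose_mul_factorial (x : ℤ_[p]) (n : ℕ) :
    (Ring.choose x n) * n.factorial = ∏ i ∈ Finset.range n, (x - i) := by
  rw [← descPochhammer_eval_eq_prod_range, ← descPochhammer_map (Int.castRingHom ℤ_[p]),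
    Polynomial.eval_map, ← algebraMap_int_eq, ← Polynomial.aeval_def, Polynomial.aeval_eq_smeval,
    Ring.descPochhammer_eq_factorial_smul_choose, nsmul_eq_mul, mul_comm]

lemma binomQ_eq (x : ℤ_[p]) (n : ℕ) : binomQ p x n = (Ring.choose x n : ℤ_[p]) := by
  rw [binomQ, div_eq_iff (mod_cast n.factorial_ne_zero)]
  have := congrArg (PadicInt.Coe.ringHom : ℤ_[p] →+* ℚ_[p]) (choose_mul_factorial x n)
  rw [map_prod, map_mul, map_natCast] at this
  exact this.symm

lemma norm_p_pow_le (j : ℕ) : ‖(p : L)‖ ^ j ≤ ‖(j.factorial : L)‖ := by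
  rw [norm_natCast_eq (p := p) (L := L), norm_natCast_eq (p := p) (L := L), Padic.norm_p,
    Padic.norm_eq_zpow_neg_valuation (mod_cast j.factorial_ne_zero), Padic.valuation_natCast,
    inv_pow, zpow_neg, zpow_natCast]
  have hp := (Fact.out : p.Prime).one_lt
  gcongr
  · exact_mod_cast hp.le
  · exact padicValNat_factorial_le p j

lemma tendsto_rpow_mul_norm_factorial (q : ℕ) [Fact q.Prime] [NormedAlgebra ℚ_[q] L] (r : ℝ) :
    Tendsto (fun M : ℕ => ((M : ℝ) + 1) ^ r * ‖(M.factorial : L)‖) atTop (𝓝 0) := by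
  have hp := (Fact.out : q.Prime)
  have hp1 : (1 : ℝ) < q := mod_cast hp.one_lt
  set K := ⌈r⌉₊
  have h1 : Tendsto (fun s : ℕ => ((s + 1 : ℕ) : ℝ) ^ K * ((q : ℝ)⁻¹) ^ (s + 1)) atTop (𝓝 0) :=
    (tendsto_pow_const_mul_const_pow_of_lt_one K (by positivity)
      (inv_lt_one_of_one_lt₀ hp1)).comp (tendsto_add_atTop_nat 1)
  have h2 := ((h1.const_mul ((q : ℝ) ^ K * q)).comp (Nat.tendsto_div_const_atTop hp.ne_zero))
  rw [mul_zero] at h2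
  refine squeeze_zero (fun M => by positivity) (fun M => ?_) h2
  have hM : ((M : ℝ) + 1) ≤ q * ((M / q + 1 : ℕ) : ℝ) := by
    exact_mod_cast Nat.lt_mul_div_succ M hp.pos
  have hf : ‖(M.factorial : L)‖ ≤ ((q : ℝ)⁻¹) ^ (M / q) := by
    rw [norm_natCast_eq (p := q), Padic.norm_eq_zpow_neg_valuation (mod_cast M.factorial_ne_zero),
      Padic.valuation_natCast, inv_pow, zpow_neg, zpow_natCast]
    have : M / q ≤ padicValNat q M.factorial := by
      rw [← padicValNat_mul_div_factorial, padicValNat_factorial_mul]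
      lia
    gcongr
    exact hp1.le
  calc ((M : ℝ) + 1) ^ r * ‖(M.factorial : L)‖
      ≤ (q * ((M / q + 1 : ℕ) : ℝ)) ^ K * ((q : ℝ)⁻¹) ^ (M / q) := by
        gcongr
        calc ((M : ℝ) + 1) ^ r ≤ ((M : ℝ) + 1) ^ (K : ℝ) :=
              Real.rpow_le_rpow_of_exponent_le (by linarith [M.cast_nonneg (α := ℝ)])
                (Nat.le_ceil r)
          _ = ((M : ℝ) + 1) ^ K := Real.rpow_natCast _ _
          _ ≤ _ := by gcongr
    _ = _ := by
        simp only [Function.comp, pow_succ, mul_pow]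
        field_simp

lemma IsCr.tendsto {r : ℝ} (hr : 0 < r) {f : ℤ_[p] → L} (hf : IsCr p L r f) :
    Tendsto (fun n : ℕ => ((n : ℝ) + 1) ^ r * ‖mahlerCoeff p L f n‖) atTop (𝓝 0) := by
  have h := hf.1.const_mul ((2 : ℝ) ^ r)
  rw [mul_zero] at h
  refine squeeze_zero' (.of_forall fun n => by positivity) ?_ h
  filter_upwards [eventually_ge_atTop 1] with n hn
  have hn' : (1 : ℝ) ≤ n := mod_cast hn
  rw [← mul_assoc, ← Real.mul_rpow (by norm_num) (by positivity)]
  gcongr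
  linarith

lemma IsCr.bddAbove {r : ℝ} (hr : 0 < r) {f : ℤ_[p] → L} (hf : IsCr p L r f) :
    BddAbove (Set.range fun n : ℕ => ((n : ℝ) + 1) ^ r * ‖mahlerCoeff p L f n‖) :=
  (hf.tendsto hr).bddAbove_range

lemma IsCr.le_crNorm {r : ℝ} (hr : 0 < r) {f : ℤ_[p] → L} (hf : IsCr p L r f) (n : ℕ) :
    ((n : ℝ) + 1) ^ r * ‖mahlerCoeff p L f n‖ ≤ crNorm p L r f :=
  le_ciSup (hf.bddAbove hr) n

lemma crNorm_nonneg (r : ℝ) (f : ℤ_[p] → L) : 0 ≤ crNorm p L r f :=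
  Real.iSup_nonneg fun n => by positivity

lemma IsCr.tendsto_mahlerCoeff {r : ℝ} (hr : 0 < r) {f : ℤ_[p] → L} (hf : IsCr p L r f) :
    Tendsto (fun n : ℕ => mahlerCoeff p L f n) atTop (𝓝 0) := by
  rw [tendsto_zero_iff_norm_tendsto_zero]
  refine squeeze_zero (fun n => norm_nonneg _) (fun n => ?_) (hf.tendsto hr)
  exact le_mul_of_one_le_left (norm_nonneg _)
    (Real.one_le_rpow (by linarith [n.cast_nonneg (α := ℝ)]) hr.le)

/-- The `ℤ_p`-module structure underlying a `ℚ_p`-algebra. -/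
abbrev padicIntModule : Module ℤ_[p] L :=
  Module.compHom L (PadicInt.Coe.ringHom : ℤ_[p] →+* ℚ_[p])

section

attribute [local instance] padicIntModule

lemma padicInt_smul_def (a : ℤ_[p]) (x : L) : a • x = algebraMap ℚ_[p] L a * x :=
  Algebra.smul_def (a : ℚ_[p]) x

lemma padicInt_isBoundedSMul : IsBoundedSMul ℤ_[p] L :=
  .of_norm_smul_le fun a x => by
    rw [padicInt_smul_def, norm_mul, norm_algebraMap']; exact le_rfl

variable [CompleteSpace L] [IsUltrametricDist L]

lemma hasSum_mahlerCoeff {f : ℤ_[p] → L} (hf : Continuous f) (z : ℤ_[p]) :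
    HasSum (fun n : ℕ => mahlerCoeff p L f n * iotaL p L (binomQ p z n)) (f z) := by
  have := padicInt_isBoundedSMul (p := p) (L := L)
  have h := ContinuousMap.hasSum_apply (PadicInt.hasSum_mahler (⟨f, hf⟩ : C(ℤ_[p], L))) z
  have e : (fun n : ℕ => mahlerCoeff p L f n * iotaL p L (binomQ p z n)) = fun n =>
      PadicInt.mahlerTerm ((fwdDiff 1)^[n] f 0) n z := funext fun n => by
    rw [PadicInt.mahlerTerm_apply, mahler_apply, padicInt_smul_def, binomQ_eq, iotaL,
      mul_comm, mahlerCoeff_eq]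
  rw [e]
  exact h

lemma IsCr.continuous {r : ℝ} (hr : 0 < r) {f : ℤ_[p] → L} (hf : IsCr p L r f) :
    Continuous f := by
  have := padicInt_isBoundedSMul (p := p) (L := L)
  have ha := hf.tendsto_mahlerCoeff hr
  have hfun : f = PadicInt.mahlerSeries (p := p) (mahlerCoeff p L f) := by
    funext z
    refine (hf.2 z).unique ?_
    have e : (fun n : ℕ => mahlerCoeff p L f n * iotaL p L (binomQ p z n)) = fun n =>
        PadicInt.mahlerTerm (mahlerCoeff p L f n) n z := funext fun n => by
      rw [PadicInt.mahlerTerm_apply, mahler_apply, padicInt_smul_def, binomQ_eq, iotaL,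
        mul_comm]
    rw [e]
    exact ContinuousMap.hasSum_apply (PadicInt.hasSum_mahlerSeries (p := p) ha) z
  rw [hfun]
  exact (PadicInt.mahlerSeries (p := p) (mahlerCoeff p L f)).continuous

end

end ClassCr

section Operators

/-- The embedding `ℤ_p → L` as a ring homomorphism. -/
def iotaInt : ℤ_[p] →+* L := (algebraMap ℚ_[p] L).comp PadicInt.Coe.ringHom

variable {p L}

lemma iotaInt_apply (x : ℤ_[p]) : iotaInt p L x = iotaL p L x := rfl

lemma norm_iotaInt (x : ℤ_[p]) : ‖iotaInt p L x‖ = ‖x‖ := norm_algebraMap' L (x : ℚ_[p])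

lemma continuous_iotaInt : Continuous (iotaInt p L) :=
  (algebraMapCLM ℚ_[p] L).continuous.comp continuous_subtype_val

lemma iotaL_binomQ (x : ℤ_[p]) (n : ℕ) :
    iotaL p L (binomQ p x n) = iotaInt p L (Ring.choose x n) := by
  rw [binomQ_eq, iotaInt_apply]

lemma natCast_ne_zero_of_padic (q : ℕ) [Fact q.Prime] [NormedAlgebra ℚ_[q] L] {n : ℕ}
    (hn : n ≠ 0) : (n : L) ≠ 0 := by
  rw [← map_natCast (algebraMap ℚ_[q] L)]
  exact (map_ne_zero _).mpr (Nat.cast_ne_zero.mpr hn)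

/-- A weight `σ` that is locally divisible to all orders on balls of radius `1/p` and smaller. -/
structure GoodWeight (σ : ℤ_[p] → L) : Prop where
  continuous : Continuous σ
  divDiff : ∀ (h : ℕ) (z : ℤ_[p]), DivDiff fun u : ℕ => σ (z + u * (p : ℤ_[p]) ^ (h + 1))

variable (L) in
/-- A self-map of `ℤ_p` whose local variations are locally divisible to all orders. -/
structure GoodMap (φ : ℤ_[p] → ℤ_[p]) : Prop where
  continuous : Continuous φ
  exists_divDiff : ∀ (h : ℕ) (z : ℤ_[p]), ∃ ψ : ℕ → L, DivDiff ψ ∧ ∀ u : ℕ,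
    iotaInt p L (φ (z + u * (p : ℤ_[p]) ^ (h + 1))) = iotaInt p L (φ z) + (p : L) ^ h * ψ u

lemma norm_p_pow_div_le {h i : ℕ} (hi0 : i ≠ 0) (hi : i < p ^ (h + 1)) :
    ‖(p : L) ^ h / (i : L)‖ ≤ 1 := by
  have hp := (Fact.out : p.Prime)
  have hi' : (i : L) ≠ 0 := natCast_ne_zero_of_padic p hi0
  rw [norm_div, div_le_one (norm_pos_iff.mpr hi'), norm_pow, norm_natCast_eq (p := p) (L := L) p,
    norm_natCast_eq (p := p) (L := L) i, Padic.norm_p,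
    Padic.norm_eq_zpow_neg_valuation (mod_cast hi0), Padic.valuation_natCast,
    inv_pow, zpow_neg, zpow_natCast]
  have h1 : padicValNat p i ≤ h :=
    (padicValNat_le_nat_log i).trans (Nat.lt_succ_iff.mp (Nat.log_lt_of_lt_pow hi0 hi))
  have hp1 : (1 : ℝ) ≤ p := mod_cast hp.one_lt.le
  gcongr

variable [IsUltrametricDist L]

lemma divDiff_iotaInt_choose {h j : ℕ} (hj : j < p ^ (h + 1)) {δ : ℕ → ℤ_[p]} {ψ : ℕ → L}
    (hψ : DivDiff ψ) (hδ : ∀ u, iotaInt p L (δ u) = (p : L) ^ h * ψ u) :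
    DivDiff fun u => iotaInt p L (Ring.choose (δ u) j) := by
  cases j with
  | zero => simpa using DivDiff.const (K := L) (c := 1) (by simp)
  | succ j =>
    have hc : ∀ i < j + 1, DivDiff fun _ : ℕ => (p : L) ^ h / ((i + 1 : ℕ) : L) := fun i hi =>
      DivDiff.const (norm_p_pow_div_le (by lia) (by lia))
    have key : (fun u => iotaInt p L (Ring.choose (δ u) (j + 1))) = fun u =>
        ((p : L) ^ h / ((j + 1 : ℕ) : L) * ψ u) *
          ∏ i ∈ Finset.range j, ((p : L) ^ h / ((i + 1 : ℕ) : L) * ψ u + -1) := by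
      funext u
      have hf : ((j + 1).factorial : L) ≠ 0 :=
        natCast_ne_zero_of_padic p (Nat.factorial_ne_zero _)
      have h1 := congrArg (iotaInt p L) (choose_mul_factorial (δ u) (j + 1))
      rw [map_mul, map_natCast, map_prod, Finset.prod_range_succ'] at h1
      simp only [map_sub, map_natCast, hδ] at h1
      refine mul_right_cancel₀ hf (h1.trans ?_)
      have h2 : ∀ i, (p : L) ^ h * ψ u - ((i + 1 : ℕ) : L)
          = ((p : L) ^ h / ((i + 1 : ℕ) : L) * ψ u + -1) * ((i + 1 : ℕ) : L) := fun i => by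
        have : ((i + 1 : ℕ) : L) ≠ 0 := natCast_ne_zero_of_padic p (by lia)
        field_simp
        ring
      have h3 : ((j + 1 : ℕ) : L) ≠ 0 := natCast_ne_zero_of_padic p (by lia)
      simp only [h2]
      rw [Finset.prod_mul_distrib, ← Nat.cast_prod, Finset.prod_range_add_one_eq_factorial,
        Nat.factorial_succ, Nat.cast_mul]
      field_simp
      push_cast
      ring
    rw [key]
    refine ((hc j (by lia)).mul hψ).mul (DivDiff.prod fun i hi => ?_)
    rw [Finset.mem_range] at hi
    exact ((hc i (by lia)).mul hψ).add (DivDiff.const (by simp))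

lemma GoodMap.divDiff_choose {φ : ℤ_[p] → ℤ_[p]} (hφ : GoodMap L φ) {h n : ℕ}
    (hn : n < p ^ (h + 1)) (z : ℤ_[p]) :
    DivDiff fun u : ℕ => iotaInt p L (Ring.choose (φ (z + u * (p : ℤ_[p]) ^ (h + 1))) n) := by
  obtain ⟨ψ, hψ, hψ'⟩ := hφ.exists_divDiff h z
  set δ : ℕ → ℤ_[p] := fun u => φ (z + u * (p : ℤ_[p]) ^ (h + 1)) - φ z with hδ
  have e : (fun u : ℕ => iotaInt p L (Ring.choose (φ (z + u * (p : ℤ_[p]) ^ (h + 1))) n)) =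
      fun u => ∑ ij ∈ Finset.HasAntidiagonal.antidiagonal n,
        iotaInt p L (Ring.choose (φ z) ij.1) * iotaInt p L (Ring.choose (δ u) ij.2) := by
    funext u
    have : φ (z + u * (p : ℤ_[p]) ^ (h + 1)) = φ z + δ u := by rw [hδ]; ring
    rw [this, Ring.add_choose_eq n (Commute.all _ _), map_sum]
    simp only [map_mul]
  rw [e]
  refine DivDiff.sum fun ij hij => ?_
  rw [Finset.HasAntidiagonal.mem_antidiagonal] at hij
  refine (DivDiff.const ?_).mul (divDiff_iotaInt_choose (h := h) (by lia) hψ fun u => ?_)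
  · rw [norm_iotaInt]; exact PadicInt.norm_le_one _
  · rw [hδ, map_sub, hψ']; ring

/-- Mahler coefficients of a weighted pulled-back binomial function. -/
lemma norm_mahlerCoeff_choose_le {σ : ℤ_[p] → L} (hσ : GoodWeight σ) {φ : ℤ_[p] → ℤ_[p]}
    (hφ : GoodMap L φ) {h n : ℕ} (hn : n < p ^ (h + 1)) (m : ℕ) :
    ‖mahlerCoeff p L (fun z => σ z * iotaInt p L (Ring.choose (φ z) n)) m‖
      ≤ ‖((m / p ^ (h + 1)).factorial : L)‖ := by
  rw [mahlerCoeff_eq_nat]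
  refine norm_fwdDiff_iter_le_of_divDiff (Fact.out : p.Prime) norm_p_pow_le (fun z => ?_) m 0
  have := (hσ.divDiff h z).mul (hφ.divDiff_choose hn z)
  simpa using this

lemma exists_rpow_mul_norm_mahlerCoeff_choose_le {r : ℝ} (hr : 0 < r) {σ : ℤ_[p] → L}
    (hσ : GoodWeight σ) {φ : ℤ_[p] → ℤ_[p]} (hφ : GoodMap L φ) :
    ∃ C : ℝ, 0 ≤ C ∧ ∀ n m : ℕ, ((m : ℝ) + 1) ^ r *
      ‖mahlerCoeff p L (fun z => σ z * iotaInt p L (Ring.choose (φ z) n)) m‖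
        ≤ C * ((n : ℝ) + 1) ^ r := by
  have hp := (Fact.out : p.Prime)
  obtain ⟨A, hA⟩ := (tendsto_rpow_mul_norm_factorial (L := L) p r).bddAbove_range
  have hA' : ∀ M : ℕ, ((M : ℝ) + 1) ^ r * ‖(M.factorial : L)‖ ≤ A := fun M => hA ⟨M, rfl⟩
  have hA0 : 0 ≤ A := le_trans (by positivity) (hA' 0)
  refine ⟨A * (p : ℝ) ^ r, by positivity, fun n m => ?_⟩
  set h := Nat.log p n
  have hn : n < p ^ (h + 1) := Nat.lt_pow_succ_log_self hp.one_lt n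
  have hn' : p ^ h ≤ n + 1 := by
    rcases eq_or_ne n 0 with h0 | h0
    · simp [h, h0]
    · exact (Nat.pow_log_le_self p h0).trans (Nat.le_succ n)
  set M := m / p ^ (h + 1)
  have hm : ((m : ℝ) + 1) ≤ ((M : ℝ) + 1) * p * ((n : ℝ) + 1) := by
    have h1 : m + 1 ≤ p ^ (h + 1) * (M + 1) := Nat.lt_mul_div_succ m (pow_pos hp.pos _)
    have h2 : p ^ (h + 1) * (M + 1) ≤ (M + 1) * p * (n + 1) := by
      rw [pow_succ]; nlinarith [Nat.mul_le_mul_left ((M + 1) * p) hn']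
    exact_mod_cast h1.trans h2
  calc _ ≤ (((M : ℝ) + 1) * p * ((n : ℝ) + 1)) ^ r * ‖(M.factorial : L)‖ := by
        gcongr
        exact norm_mahlerCoeff_choose_le hσ hφ hn m
    _ = (((M : ℝ) + 1) ^ r * ‖(M.factorial : L)‖) * (p : ℝ) ^ r * ((n : ℝ) + 1) ^ r := by
        rw [Real.mul_rpow (by positivity) (by positivity),
          Real.mul_rpow (by positivity) (by positivity)]
        ring
    _ ≤ _ := by gcongr; exact hA' M

lemma tendsto_rpow_mul_norm_mahlerCoeff_choose {r : ℝ} (hr : 0 < r) {σ : ℤ_[p] → L}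
    (hσ : GoodWeight σ) {φ : ℤ_[p] → ℤ_[p]} (hφ : GoodMap L φ) (n : ℕ) :
    Tendsto (fun m : ℕ => ((m : ℝ) + 1) ^ r *
      ‖mahlerCoeff p L (fun z => σ z * iotaInt p L (Ring.choose (φ z) n)) m‖) atTop (𝓝 0) := by
  have hp := (Fact.out : p.Prime)
  set h := Nat.log p n
  have hn : n < p ^ (h + 1) := Nat.lt_pow_succ_log_self hp.one_lt n
  have h1 := ((tendsto_rpow_mul_norm_factorial (L := L) p r).comp
    (Nat.tendsto_div_const_atTop (pow_ne_zero (h + 1) hp.ne_zero))).const_mul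
      (((p ^ (h + 1) : ℕ) : ℝ) ^ r)
  rw [mul_zero] at h1
  refine squeeze_zero (fun m => by positivity) (fun m => ?_) h1
  have hm : ((m : ℝ) + 1) ≤ ((p ^ (h + 1) : ℕ) : ℝ) * (((m / p ^ (h + 1) : ℕ) : ℝ) + 1) := by
    exact_mod_cast Nat.lt_mul_div_succ m (pow_pos hp.pos _)
  simp only [Function.comp]
  rw [← mul_assoc, ← Real.mul_rpow (by positivity) (by positivity)]
  gcongr
  exact norm_mahlerCoeff_choose_le hσ hφ hn m

variable [CompleteSpace L]

lemma hasSum_mahlerCoeff_comp {r : ℝ} (σ : ℤ_[p] → L) (φ : ℤ_[p] → ℤ_[p])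
    {f : ℤ_[p] → L} (hf : IsCr p L r f) (m : ℕ) :
    HasSum (fun n => mahlerCoeff p L f n *
      mahlerCoeff p L (fun z => σ z * iotaInt p L (Ring.choose (φ z) n)) m)
      (mahlerCoeff p L (fun z => σ z * f (φ z)) m) := by
  simp only [mahlerCoeff.eq_def p L (fun z => σ z * _), Finset.mul_sum]
  refine hasSum_sum fun i _ => ?_
  have := (hf.2 (φ ((m - i : ℕ) : ℤ_[p]))).mul_left
    ((-1 : L) ^ i * (m.choose i : L) * σ ((m - i : ℕ) : ℤ_[p]))
  simp only [iotaL_binomQ] at this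
  simp only [mul_left_comm _ (mahlerCoeff p L f _)] at this
  simp only [← mul_assoc ((-1 : L) ^ i * (m.choose i : L))]
  exact this

/-- Weighted composition operators preserve class `C^r`. -/
theorem exists_crNorm_comp_le {r : ℝ} (hr : 0 < r) {σ : ℤ_[p] → L}
    (hσ : GoodWeight σ) {φ : ℤ_[p] → ℤ_[p]} (hφ : GoodMap L φ) :
    ∃ C : ℝ, 0 ≤ C ∧ ∀ f : ℤ_[p] → L, IsCr p L r f →
      IsCr p L r (fun z => σ z * f (φ z)) ∧
        crNorm p L r (fun z => σ z * f (φ z)) ≤ C * crNorm p L r f := by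
  obtain ⟨C, hC0, hC⟩ := exists_rpow_mul_norm_mahlerCoeff_choose_le hr hσ hφ
  refine ⟨C, hC0, fun f hf => ?_⟩
  set c : ℕ → ℕ → L := fun n m =>
    mahlerCoeff p L (fun z => σ z * iotaInt p L (Ring.choose (φ z) n)) m
  have hterm : ∀ n m : ℕ, ((m : ℝ) + 1) ^ r * ‖mahlerCoeff p L f n * c n m‖ ≤
      C * (((n : ℝ) + 1) ^ r * ‖mahlerCoeff p L f n‖) := fun n m => by
    rw [norm_mul]
    calc _ = ‖mahlerCoeff p L f n‖ * (((m : ℝ) + 1) ^ r * ‖c n m‖) := by ring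
      _ ≤ ‖mahlerCoeff p L f n‖ * (C * ((n : ℝ) + 1) ^ r) :=
        mul_le_mul_of_nonneg_left (hC n m) (norm_nonneg _)
      _ = _ := by ring
  have hle : ∀ (m : ℕ) (B : ℝ), (∀ n, ((m : ℝ) + 1) ^ r * ‖mahlerCoeff p L f n * c n m‖ ≤ B) →
      ((m : ℝ) + 1) ^ r * ‖mahlerCoeff p L (fun z => σ z * f (φ z)) m‖ ≤ B := fun m B hB => by
    have hpos : (0 : ℝ) < ((m : ℝ) + 1) ^ r := by positivity
    rw [← (hasSum_mahlerCoeff_comp σ φ hf m).tsum_eq, ← le_div_iff₀' hpos]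
    exact IsUltrametricDist.norm_tsum_le_of_forall_le fun n => (le_div_iff₀' hpos).mpr (hB n)
  refine ⟨⟨?_, fun z => hasSum_mahlerCoeff
    (hσ.continuous.mul ((hf.continuous hr).comp hφ.continuous)) z⟩, ?_⟩
  · have htend : Tendsto (fun m : ℕ => ((m : ℝ) + 1) ^ r *
        ‖mahlerCoeff p L (fun z => σ z * f (φ z)) m‖) atTop (𝓝 0) := by
      have h0 : ∀ n, Tendsto (fun m : ℕ => ((m : ℝ) + 1) ^ r * ‖mahlerCoeff p L f n * c n m‖)
          atTop (𝓝 0) := fun n => by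
        have h1 := (tendsto_rpow_mul_norm_mahlerCoeff_choose hr hσ hφ n).const_mul
          ‖mahlerCoeff p L f n‖
        simpa only [norm_mul, mul_zero, mul_left_comm] using h1
      refine tendsto_order.mpr ⟨fun a ha => .of_forall fun m => ha.trans_le (by positivity),
        fun ε hε => ?_⟩
      have h1 := (hf.tendsto hr).const_mul C
      rw [mul_zero] at h1
      obtain ⟨N, hN⟩ := eventually_atTop.mp (h1.eventually_lt_const (half_pos hε))
      have h2 : ∀ᶠ m : ℕ in atTop, ∀ n ∈ Finset.range N,
          ((m : ℝ) + 1) ^ r * ‖mahlerCoeff p L f n * c n m‖ < ε / 2 :=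
        (Finset.eventually_all _).mpr fun n _ => (h0 n).eventually_lt_const (half_pos hε)
      filter_upwards [h2] with m hm
      refine (hle m (ε / 2) fun n => ?_).trans_lt (half_lt_self hε)
      by_cases hn : n < N
      · exact (hm n (Finset.mem_range.mpr hn)).le
      · exact (hterm n m).trans (hN n (not_lt.mp hn)).le
    refine squeeze_zero (fun n => by positivity) (fun n => ?_) htend
    gcongr
    linarith
  · refine ciSup_le fun m => hle m _ fun n => (hterm n m).trans ?_
    gcongr
    exact hf.le_crNorm hr n

end Operators

section GoodExamples

variable {p L}

lemma norm_natCast_mul_p_pow_lt_one (u h : ℕ) : ‖(u : ℤ_[p]) * (p : ℤ_[p]) ^ (h + 1)‖ < 1 := by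
  rw [norm_mul, norm_pow]
  have h1 : ‖(p : ℤ_[p])‖ < 1 := by
    rw [PadicInt.norm_p]
    exact inv_lt_one_of_one_lt₀ (mod_cast (Fact.out : p.Prime).one_lt)
  exact (mul_le_of_le_one_left (by positivity) (PadicInt.norm_le_one _)).trans_lt
    (pow_lt_one₀ (norm_nonneg _) h1 (by lia))

lemma norm_add_lt_one_iff {z x : ℤ_[p]} (hx : ‖x‖ < 1) : ‖z + x‖ < 1 ↔ ‖z‖ < 1 := by
  constructor
  · intro h
    have := (IsUltrametricDist.norm_add_le_max (z + x) (-x)).trans_lt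
      (max_lt h (by rwa [norm_neg]))
    rwa [add_neg_cancel_right] at this
  · intro h
    exact (IsUltrametricDist.norm_add_le_max z x).trans_lt (max_lt h hx)

lemma one_le_norm_sub {x y : ℤ_[p]} (hx : ‖x‖ < 1) (hy : ¬ ‖y‖ < 1) :
    1 ≤ ‖x - y‖ ∧ 1 ≤ ‖y - x‖ := by
  have h : 1 ≤ ‖y - x‖ := by
    by_contra! h
    have := (norm_add_lt_one_iff (z := x) (x := y - x) h).mpr hx
    rw [add_sub_cancel] at this
    exact hy this
  exact ⟨by rwa [norm_sub_rev], h⟩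

lemma norm_eq_one_of_not_lt {z : ℤ_[p]} (hz : ¬ ‖z‖ < 1) : ‖z‖ = 1 :=
  le_antisymm (PadicInt.norm_le_one _) (not_lt.mp hz)

lemma one_le_prime_cast : (1 : ℝ) ≤ p := mod_cast (Fact.out : p.Prime).one_lt.le

/-- Division by `p` on `pℤ_p`, extended by `0`. -/
def divP (z : ℤ_[p]) : ℤ_[p] := if h : (p : ℤ_[p]) ∣ z then h.choose else 0

lemma p_mul_divP {z : ℤ_[p]} (hz : ‖z‖ < 1) : (p : ℤ_[p]) * divP z = z := by
  have h : (p : ℤ_[p]) ∣ z := (PadicInt.norm_lt_one_iff_dvd z).mp hz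
  rw [divP, dif_pos h]
  exact h.choose_spec.symm

lemma divP_of_not_lt {z : ℤ_[p]} (hz : ¬ ‖z‖ < 1) : divP z = 0 := by
  rw [divP, dif_neg fun h => hz ((PadicInt.norm_lt_one_iff_dvd z).mpr h)]

lemma inv_of_lt {z : ℤ_[p]} (hz : ‖z‖ < 1) : z.inv = 0 := by
  rcases z with ⟨z, hz'⟩
  exact dif_neg fun h => hz.ne h

lemma iotaInt_inv {z : ℤ_[p]} (hz : ‖z‖ = 1) : iotaInt p L z.inv = (iotaInt p L z)⁻¹ := by
  refine eq_inv_of_mul_eq_one_right ?_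
  rw [← map_mul, PadicInt.mul_inv hz, map_one]

lemma GoodMap.of_norm_sub_le {φ : ℤ_[p] → ℤ_[p]} (hφ : ∀ x y, ‖φ x - φ y‖ ≤ p * ‖x - y‖)
    (h : ∀ (h : ℕ) (z : ℤ_[p]), ∃ ψ : ℕ → L, DivDiff ψ ∧ ∀ u : ℕ,
      iotaInt p L (φ (z + u * (p : ℤ_[p]) ^ (h + 1)))
        = iotaInt p L (φ z) + (p : L) ^ h * ψ u) : GoodMap L φ where
  continuous := (LipschitzWith.of_dist_le_mul (K := (p : NNReal)) fun x y => by
    simpa [dist_eq_norm] using hφ x y).continuous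
  exists_divDiff := h

variable [IsUltrametricDist L]

lemma norm_p_pow_le_one (n : ℕ) : ‖(p : L) ^ n‖ ≤ 1 := by
  rw [norm_pow]; exact pow_le_one₀ (norm_nonneg _) (IsUltrametricDist.norm_natCast_le_one L p)

lemma norm_iotaInt_le_one (x : ℤ_[p]) : ‖iotaInt p L x‖ ≤ 1 := by
  rw [norm_iotaInt]; exact PadicInt.norm_le_one x

lemma goodMap_affine (a b : ℤ_[p]) : GoodMap L fun z => a * z + b := by
  refine .of_norm_sub_le (fun x y => ?_) fun h z => ?_
  · rw [show a * x + b - (a * y + b) = a * (x - y) by ring, norm_mul]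
    gcongr
    exact (PadicInt.norm_le_one a).trans one_le_prime_cast
  · refine ⟨fun u => iotaInt p L a * p * u, (DivDiff.const ?_).mul .natCast, fun u => ?_⟩
    · simpa using norm_iotaInt_le_one (L := L) (a * (p : ℤ_[p]))
    · simp only [map_add, map_mul, map_natCast, map_pow]
      ring

lemma goodMap_divP : GoodMap L (divP (p := p)) := by
  refine .of_norm_sub_le (fun x y => ?_) fun h z => ?_
  · have hb : ∀ w : ℤ_[p], ‖w‖ ≤ 1 := PadicInt.norm_le_one
    have hp1 := one_le_prime_cast (p := p)
    by_cases hx : ‖x‖ < 1 <;> by_cases hy : ‖y‖ < 1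
    · conv_rhs => rw [← p_mul_divP hx, ← p_mul_divP hy, ← mul_sub, norm_mul, PadicInt.norm_p]
      rw [mul_inv_cancel_left₀ (by positivity)]
    · nlinarith [hb (divP x - divP y), (one_le_norm_sub hx hy).1]
    · nlinarith [hb (divP x - divP y), (one_le_norm_sub hy hx).2]
    · rw [divP_of_not_lt hx, divP_of_not_lt hy, sub_self, norm_zero]
      positivity
  · by_cases hz : ‖z‖ < 1
    · refine ⟨fun u => u, .natCast, fun u => ?_⟩
      have hz' := (norm_add_lt_one_iff (norm_natCast_mul_p_pow_lt_one u h)).mpr hz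
      have hp : (p : ℤ_[p]) ≠ 0 := mod_cast (Fact.out : p.Prime).ne_zero
      have e : divP (z + (u : ℤ_[p]) * (p : ℤ_[p]) ^ (h + 1)) = divP z + (p : ℤ_[p]) ^ h * (u : ℤ_[p]) := by
        apply mul_left_cancel₀ hp
        rw [p_mul_divP hz', mul_add, p_mul_divP hz]
        ring
      rw [e]
      simp
    · refine ⟨fun _ => 0, .const (by simp), fun u => ?_⟩
      rw [divP_of_not_lt hz, divP_of_not_lt]
      · simp
      · rwa [norm_add_lt_one_iff (norm_natCast_mul_p_pow_lt_one u h)]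

lemma norm_iotaInt_add_mul {z : ℤ_[p]} (hz : ¬ ‖z‖ < 1) (h u : ℕ) :
    ‖iotaInt p L z + (p : L) ^ (h + 1) * u‖ = 1 := by
  have : iotaInt p L z + (p : L) ^ (h + 1) * u
      = iotaInt p L (z + u * (p : ℤ_[p]) ^ (h + 1)) := by simp; ring
  rw [this, norm_iotaInt]
  exact norm_eq_one_of_not_lt
    (by rwa [norm_add_lt_one_iff (norm_natCast_mul_p_pow_lt_one u h)])

lemma inv_affine_sub_inv {s t : L} (hs : s ≠ 0) (u : ℕ) (hu : s + t * u ≠ 0) :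
    (s + t * u)⁻¹ = s⁻¹ + -(t * s⁻¹ * u * (s + t * u)⁻¹) := by
  field_simp
  ring

lemma goodMap_inv : GoodMap L (PadicInt.inv (p := p)) := by
  refine .of_norm_sub_le (fun x y => ?_) fun h z => ?_
  · have hb : ∀ w : ℤ_[p], ‖w‖ ≤ 1 := PadicInt.norm_le_one
    have hp1 := one_le_prime_cast (p := p)
    by_cases hx : ‖x‖ < 1 <;> by_cases hy : ‖y‖ < 1
    · rw [inv_of_lt hx, inv_of_lt hy, sub_self, norm_zero]
      positivity
    · nlinarith [hb (x.inv - y.inv), (one_le_norm_sub hx hy).1]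
    · nlinarith [hb (x.inv - y.inv), (one_le_norm_sub hy hx).2]
    · have h1 := PadicInt.mul_inv (norm_eq_one_of_not_lt hx)
      have h2 := PadicInt.mul_inv (norm_eq_one_of_not_lt hy)
      have e : x.inv - y.inv = (x.inv * y.inv) * -(x - y) := by
        linear_combination y.inv * h1 - x.inv * h2
      rw [e, norm_mul, norm_neg]
      gcongr
      exact (hb _).trans hp1
  · by_cases hz : ‖z‖ < 1
    · refine ⟨fun _ => 0, .const (by simp), fun u => ?_⟩
      rw [inv_of_lt hz, inv_of_lt]
      · simp
      · rwa [norm_add_lt_one_iff (norm_natCast_mul_p_pow_lt_one u h)]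
    · have hz1 := norm_eq_one_of_not_lt hz
      have hn := norm_iotaInt_add_mul (L := L) hz h
      refine ⟨fun u => -1 * ((p * (iotaInt p L z)⁻¹) * u *
        (iotaInt p L z + (p : L) ^ (h + 1) * u)⁻¹), (DivDiff.const (by simp)).mul
          (((DivDiff.const ?_).mul .natCast).mul (.inv_affine hn (norm_p_pow_le_one _))),
          fun u => ?_⟩
      · rw [norm_mul, norm_inv, norm_iotaInt, hz1, inv_one, mul_one]
        exact IsUltrametricDist.norm_natCast_le_one L p
      · have hz' : ‖z + u * (p : ℤ_[p]) ^ (h + 1)‖ = 1 := norm_eq_one_of_not_lt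
          (by rwa [norm_add_lt_one_iff (norm_natCast_mul_p_pow_lt_one u h)])
        have h0 : iotaInt p L z ≠ 0 := norm_ne_zero_iff.mp (by rw [norm_iotaInt, hz1]; simp)
        have h0' : iotaInt p L z + (p : L) ^ (h + 1) * u ≠ 0 :=
          norm_ne_zero_iff.mp (by rw [hn]; simp)
        have e : iotaInt p L (z + u * (p : ℤ_[p]) ^ (h + 1))
            = iotaInt p L z + (p : L) ^ (h + 1) * u := by simp; ring
        rw [iotaInt_inv hz', iotaInt_inv hz1, e, inv_affine_sub_inv h0 u h0']
        ring

lemma norm_one_sub_p_mul (z : ℤ_[p]) : ‖1 - p * z‖ = 1 := by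
  have h := norm_natCast_mul_p_pow_lt_one (p := p) 1 0
  refine norm_eq_one_of_not_lt ?_
  rw [sub_eq_add_neg, norm_add_lt_one_iff]
  · simp
  · rw [norm_neg, norm_mul]
    refine (mul_le_of_le_one_right (norm_nonneg _) (PadicInt.norm_le_one z)).trans_lt ?_
    simpa using h

/-- The Möbius map `z ↦ z / (1 - pz)`. -/
def moebP (z : ℤ_[p]) : ℤ_[p] := z * (1 - p * z).inv

lemma goodMap_moebP : GoodMap L (moebP (p := p)) := by
  have hinv : ∀ z : ℤ_[p], (1 - p * z) * (1 - p * z).inv = 1 := fun z =>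
    PadicInt.mul_inv (norm_one_sub_p_mul z)
  refine .of_norm_sub_le (fun x y => ?_) fun h z => ?_
  · have e : moebP x - moebP y = ((1 - p * x).inv * (1 - p * y).inv) * (x - y) := by
      rw [moebP, moebP]
      linear_combination (-(x * (1 - p * x).inv)) * hinv y + (y * (1 - p * y).inv) * hinv x
    rw [e, norm_mul]
    gcongr
    exact (PadicInt.norm_le_one _).trans one_le_prime_cast
  · set w := 1 - p * z with hw
    have hw1 : ‖w‖ = 1 := norm_one_sub_p_mul z
    have e : ∀ u : ℕ, iotaInt p L (1 - p * (z + u * (p : ℤ_[p]) ^ (h + 1)))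
        = iotaInt p L w + -(p : L) ^ (h + 2) * u := fun u => by
      rw [hw]
      simp only [map_add, map_mul, map_natCast, map_pow, map_sub, map_one]
      ring
    refine ⟨fun u => (p * (iotaInt p L w)⁻¹) * u * (iotaInt p L w + -(p : L) ^ (h + 2) * u)⁻¹,
      ((DivDiff.const ?_).mul .natCast).mul (.inv_affine (fun u => ?_) ?_), fun u => ?_⟩
    · rw [norm_mul, norm_inv, norm_iotaInt, hw1, inv_one, mul_one]
      exact IsUltrametricDist.norm_natCast_le_one L p
    · rw [← e, norm_iotaInt, norm_one_sub_p_mul]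
    · rw [norm_neg]; exact norm_p_pow_le_one _
    · have h0 : iotaInt p L w ≠ 0 := norm_ne_zero_iff.mp (by rw [norm_iotaInt, hw1]; simp)
      have h1 : iotaInt p L w + -(p : L) ^ (h + 2) * u ≠ 0 :=
        norm_ne_zero_iff.mp (by rw [← e, norm_iotaInt, norm_one_sub_p_mul]; simp)
      rw [moebP, moebP, map_mul, map_mul, iotaInt_inv (norm_one_sub_p_mul _), iotaInt_inv hw1, e]
      have hz : (p : L) * iotaInt p L z = 1 - iotaInt p L w := by rw [hw]; simp
      simp only [map_add, map_mul, map_natCast, map_pow]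
      generalize hD : iotaInt p L w + -(p : L) ^ (h + 2) * u = D at h1 ⊢
      field_simp
      linear_combination (p : L) ^ (h + 1) * u * hz + iotaInt p L z * hD

lemma goodWeight_one : GoodWeight (p := p) (L := L) fun _ => 1 :=
  ⟨continuous_const, fun _ _ => .const (by simp)⟩

lemma isClopen_norm_lt_one : IsClopen {z : ℤ_[p] | ‖z‖ < 1} := by
  have : {z : ℤ_[p] | ‖z‖ < 1} = Metric.ball 0 1 := by ext; simp
  rw [this]
  exact IsUltrametricDist.isClopen_ball _ _

lemma GoodWeight.ite {σ τ : ℤ_[p] → L} (hσ : GoodWeight σ) (hτ : GoodWeight τ) :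
    GoodWeight fun z => if ‖z‖ < 1 then σ z else τ z := by
  refine ⟨hσ.continuous.if (fun a ha => ?_) hτ.continuous, fun h z => ?_⟩
  · rw [isClopen_norm_lt_one.frontier_eq] at ha
    exact ha.elim
  · simp only [norm_add_lt_one_iff (norm_natCast_mul_p_pow_lt_one _ h)]
    split_ifs
    · exact hσ.divDiff h z
    · exact hτ.divDiff h z

lemma goodWeight_zero : GoodWeight (p := p) (L := L) fun _ => 0 :=
  ⟨continuous_const, fun _ _ => .const (by simp)⟩

lemma goodWeight_affine_pow (a b : ℤ_[p]) (n : ℕ) :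
    GoodWeight fun z => iotaInt p L (a * z + b) ^ n := by
  refine ⟨(continuous_iotaInt.comp (by fun_prop)).pow n, fun h z => ?_⟩
  have e : (fun u : ℕ => iotaInt p L (a * (z + u * (p : ℤ_[p]) ^ (h + 1)) + b) ^ n) = fun u : ℕ =>
      (iotaInt p L (a * z + b) + iotaInt p L (a * (p : ℤ_[p]) ^ (h + 1)) * (u : ℕ)) ^ n := by
    funext u
    simp only [map_add, map_mul, map_natCast, map_pow]
    ring
  rw [e]
  exact (DivDiff.affine (norm_iotaInt_le_one _) (norm_iotaInt_le_one _)).pow n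

end GoodExamples

section CrLinear

variable {p L}

lemma mahlerCoeff_add (f g : ℤ_[p] → L) (n : ℕ) :
    mahlerCoeff p L (fun z => f z + g z) n = mahlerCoeff p L f n + mahlerCoeff p L g n := by
  simp only [mahlerCoeff, ← Finset.sum_add_distrib, mul_add]

lemma mahlerCoeff_const_mul (c : L) (f : ℤ_[p] → L) (n : ℕ) :
    mahlerCoeff p L (fun z => c * f z) n = c * mahlerCoeff p L f n := by
  simp only [mahlerCoeff, Finset.mul_sum, mul_left_comm]

lemma IsCr.add {r : ℝ} {f g : ℤ_[p] → L} (hf : IsCr p L r f) (hg : IsCr p L r g) :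
    IsCr p L r fun z => f z + g z := by
  refine ⟨?_, fun z => ?_⟩
  · have h := hf.1.add hg.1
    rw [add_zero] at h
    refine squeeze_zero (fun n => by positivity) (fun n => ?_) h
    rw [mahlerCoeff_add, ← mul_add]
    gcongr
    exact norm_add_le _ _
  · simpa only [mahlerCoeff_add, add_mul] using (hf.2 z).add (hg.2 z)

lemma IsCr.const_mul {r : ℝ} (c : L) {f : ℤ_[p] → L} (hf : IsCr p L r f) :
    IsCr p L r fun z => c * f z := by
  refine ⟨?_, fun z => ?_⟩
  · have h := hf.1.const_mul ‖c‖
    rw [mul_zero] at h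
    simpa only [mahlerCoeff_const_mul, norm_mul, mul_left_comm] using h
  · simpa only [mahlerCoeff_const_mul, mul_assoc] using (hf.2 z).mul_left c

lemma crNorm_add_le {r : ℝ} (hr : 0 < r) {f g : ℤ_[p] → L} (hf : IsCr p L r f)
    (hg : IsCr p L r g) :
    crNorm p L r (fun z => f z + g z) ≤ crNorm p L r f + crNorm p L r g := by
  refine ciSup_le fun n => ?_
  rw [mahlerCoeff_add]
  calc _ ≤ ((n : ℝ) + 1) ^ r * (‖mahlerCoeff p L f n‖ + ‖mahlerCoeff p L g n‖) := by
        gcongr; exact norm_add_le _ _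
    _ ≤ _ := by rw [mul_add]; exact add_le_add (hf.le_crNorm hr n) (hg.le_crNorm hr n)

lemma crNorm_const_mul_le {r : ℝ} (hr : 0 < r) (c : L) {f : ℤ_[p] → L} (hf : IsCr p L r f) :
    crNorm p L r (fun z => c * f z) ≤ ‖c‖ * crNorm p L r f := by
  refine ciSup_le fun n => ?_
  rw [mahlerCoeff_const_mul, norm_mul, mul_left_comm]
  gcongr
  exact hf.le_crNorm hr n

end CrLinear

section Banach

variable {p}

/-- The multiplicative weight `x ↦ (αp/β)^{val x} x^{k-2}`. -/
def chi (k : ℕ) (α β : L) (x : ℚ_[p]) : L :=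
  (α * (p : L) / β) ^ x.valuation * iotaL p L x ^ (k - 2)

/-- The homogeneous function on `ℚ_p² ∖ {0}` attached to `f`. -/
def homB (k : ℕ) (α β : L) (f : ℚ_[p] → L) (x y : ℚ_[p]) : L :=
  if y = 0 then chi L k α β x * ext2 p L k α β f 0 else chi L k α β y * f (x / y)

variable {L} {k : ℕ} {α β : L}

lemma ne_zero_of_valL_pos {x : L} (h : 0 < valL p L x) : x ≠ 0 := by
  rintro rfl
  simp [valL] at h

lemma Hyps.ratio_ne_zero (h : Hyps p L k α β) : α * (p : L) / β ≠ 0 :=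
  div_ne_zero (mul_ne_zero (ne_zero_of_valL_pos h.2.2.1)
    (natCast_ne_zero_of_padic p (Fact.out : p.Prime).ne_zero)) (ne_zero_of_valL_pos h.2.2.2.1)

lemma chi_mul (h : Hyps p L k α β) {x y : ℚ_[p]} (hx : x ≠ 0) (hy : y ≠ 0) :
    chi L k α β (x * y) = chi L k α β x * chi L k α β y := by
  simp only [chi, iotaL]
  rw [Padic.valuation_mul hx hy, zpow_add₀ h.ratio_ne_zero, map_mul, mul_pow]
  ring

lemma chi_of_norm_eq_one {x : ℤ_[p]} (hx : ‖x‖ = 1) :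
    chi L k α β (x : ℚ_[p]) = iotaInt p L x ^ (k - 2) := by
  have h0 : (x : ℚ_[p]).valuation = 0 := by
    have hx0 : (x : ℚ_[p]) ≠ 0 := by
      rw [← norm_ne_zero_iff, PadicInt.padic_norm_e_of_padicInt, hx]; simp
    have h1 := Padic.norm_eq_zpow_neg_valuation hx0
    rw [PadicInt.padic_norm_e_of_padicInt, hx] at h1
    have hp1 : (1 : ℝ) < p := mod_cast (Fact.out : p.Prime).one_lt
    have := (zpow_right_injective₀ (by positivity) hp1.ne' : Function.Injective _)
      (h1.symm.trans (zpow_zero (p : ℝ)).symm)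
    simpa using this
  rw [chi, h0, zpow_zero, one_mul, iotaInt_apply]

lemma chi_one : chi L k α β (1 : ℚ_[p]) = 1 := by
  simpa using chi_of_norm_eq_one (L := L) (k := k) (α := α) (β := β) (x := (1 : ℤ_[p])) (by simp)

lemma homB_mul (h : Hyps p L k α β) (f : ℚ_[p] → L) {t : ℚ_[p]} (ht : t ≠ 0) {x y : ℚ_[p]}
    (hxy : x ≠ 0 ∨ y ≠ 0) :
    homB L k α β f (t * x) (t * y) = chi L k α β t * homB L k α β f x y := by
  by_cases hy : y = 0
  · have hx : x ≠ 0 := hxy.resolve_right (not_not.mpr hy)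
    rw [homB, homB, if_pos (by rw [hy, mul_zero]), if_pos hy, chi_mul h ht hx, mul_assoc]
  · rw [homB, homB, if_neg (mul_ne_zero ht hy), if_neg hy, chi_mul h ht hy, mul_assoc,
      mul_div_mul_left _ _ ht]

lemma homB_one_right (f : ℚ_[p] → L) (x : ℚ_[p]) : homB L k α β f x 1 = f x := by
  rw [homB, if_neg one_ne_zero, chi_one, one_mul, div_one]

lemma gAct_eq {m : Matrix (Fin 2) (Fin 2) ℚ_[p]} (hm : det2 p m ≠ 0) (f : ℚ_[p] → L)
    (z : ℚ_[p]) : gAct p L k α β m f z = α ^ (-(det2 p m).valuation) *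
      homB L k α β f (m 1 1 * z - m 0 1) (-(m 1 0) * z + m 0 0) := by
  rw [gAct, homB]
  split_ifs with h0
  · have h10 : m 1 0 ≠ 0 := fun h10 => hm <| by
      have : m 0 0 = 0 := by simpa [h10] using h0
      simp [det2, h10, this]
    have e : det2 p m / m 1 0 = m 1 1 * z - m 0 1 := by
      rw [div_eq_iff h10, det2]
      linear_combination m 1 1 * h0
    rw [e, chi]
    ring
  · rw [chi]
    ring

lemma MemB.ext2_spec {f : ℚ_[p] → L} (hf : MemB p L k α β f) :
    Ext2 p L k α β f (ext2 p L k α β f) := by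
  rw [ext2, dif_pos hf.2]
  exact hf.2.choose_spec

variable [IsUltrametricDist L] [CompleteSpace L]

lemma Ext2.ext2_eq (h : Hyps p L k α β) {f : ℚ_[p] → L} {g : ℤ_[p] → L}
    (hg : Ext2 p L k α β f g) : ext2 p L k α β f = g := by
  have hs : Ext2 p L k α β f (ext2 p L k α β f) := by
    rw [ext2, dif_pos ⟨g, hg⟩]
    exact Exists.choose_spec (⟨g, hg⟩ : ∃ g, Ext2 p L k α β f g)
  have hr := h.2.2.1
  have key : ∀ z : ℤ_[p], z ≠ 0 → ext2 p L k α β f z = g z := fun z hz =>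
    (hs.2 z hz).trans (hg.2 z hz).symm
  have hp0 : (p : ℤ_[p]) ≠ 0 := mod_cast (Fact.out : p.Prime).ne_zero
  have ht : Tendsto (fun n : ℕ => (p : ℤ_[p]) ^ n) atTop (𝓝 0) :=
    tendsto_pow_atTop_nhds_zero_of_norm_lt_one
      (by simpa using norm_natCast_mul_p_pow_lt_one (p := p) 1 0)
  funext z
  by_cases hz : z = 0
  · subst hz
    refine tendsto_nhds_unique (((hs.1.continuous hr).tendsto 0).comp ht) ?_
    refine (((hg.1.continuous hr).tendsto 0).comp ht).congr fun n => ?_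
    exact (key _ (pow_ne_zero n hp0)).symm
  · exact key z hz

lemma homB_one_left {f : ℚ_[p] → L} (hf : MemB p L k α β f) (z : ℤ_[p]) :
    homB L k α β f 1 z = ext2 p L k α β f z := by
  by_cases hz : z = 0
  · simp [homB, hz, chi_one]
  · have hz' : (z : ℚ_[p]) ≠ 0 := fun e => hz (Subtype.ext e)
    rw [homB, if_neg hz', hf.ext2_spec.2 z hz, chi, one_div]

variable (k α β) in
/-- A bounded operator from `B(α)` to functions of class `C^{val α}`. -/
def BddOp (T : (ℚ_[p] → L) → ℤ_[p] → L) : Prop :=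
  ∃ C : ℝ, 0 ≤ C ∧ ∀ f, MemB p L k α β f → IsCr p L (valL p L α) (T f) ∧
    crNorm p L (valL p L α) (T f) ≤ C * bNorm p L k α β f

lemma bNorm_nonneg (f : ℚ_[p] → L) : 0 ≤ bNorm p L k α β f :=
  le_max_of_le_left (crNorm_nonneg _ _)

namespace BddOp

lemma mulP : BddOp k α β fun (f : ℚ_[p] → L) (z : ℤ_[p]) => f ((p : ℚ_[p]) * (z : ℚ_[p])) :=
  ⟨1, zero_le_one, fun _ hf => ⟨hf.1, by rw [one_mul]; exact le_max_left _ _⟩⟩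

lemma ext2 : BddOp k α β fun (f : ℚ_[p] → L) => ext2 p L k α β f :=
  ⟨1, zero_le_one, fun _ hf => ⟨hf.ext2_spec.1, by rw [one_mul]; exact le_max_right _ _⟩⟩

variable {S T : (ℚ_[p] → L) → ℤ_[p] → L}

lemma congr (hT : BddOp k α β T) (hST : ∀ f, MemB p L k α β f → ∀ z, S f z = T f z) :
    BddOp k α β S := by
  obtain ⟨C, hC, h⟩ := hT
  refine ⟨C, hC, fun f hf => ?_⟩
  rw [show S f = T f from funext (hST f hf)]
  exact h f hf

lemma add (hr : 0 < valL p L α) (hS : BddOp k α β S) (hT : BddOp k α β T) :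
    BddOp k α β fun f z => S f z + T f z := by
  obtain ⟨C, hC, h⟩ := hS
  obtain ⟨D, hD, h'⟩ := hT
  refine ⟨C + D, by positivity, fun f hf => ⟨(h f hf).1.add (h' f hf).1, ?_⟩⟩
  rw [add_mul]
  exact (crNorm_add_le hr (h f hf).1 (h' f hf).1).trans (add_le_add (h f hf).2 (h' f hf).2)

lemma const_mul (hr : 0 < valL p L α) (c : L) (hT : BddOp k α β T) :
    BddOp k α β fun f z => c * T f z := by
  obtain ⟨C, hC, h⟩ := hT
  refine ⟨‖c‖ * C, by positivity, fun f hf => ⟨(h f hf).1.const_mul c, ?_⟩⟩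
  refine (crNorm_const_mul_le hr c (h f hf).1).trans ?_
  rw [mul_assoc]
  exact mul_le_mul_of_nonneg_left (h f hf).2 (norm_nonneg c)

lemma comp (hr : 0 < valL p L α) {σ : ℤ_[p] → L} (hσ : GoodWeight σ) {φ : ℤ_[p] → ℤ_[p]}
    (hφ : GoodMap L φ) (hT : BddOp k α β T) : BddOp k α β fun f z => σ z * T f (φ z) := by
  obtain ⟨C, hC, h⟩ := hT
  obtain ⟨D, hD, h'⟩ := exists_crNorm_comp_le hr hσ hφ
  refine ⟨D * C, by positivity, fun f hf => ⟨(h' _ (h f hf).1).1, ?_⟩⟩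
  refine (h' _ (h f hf).1).2.trans ?_
  rw [mul_assoc]
  exact mul_le_mul_of_nonneg_left (h f hf).2 hD

lemma comp_map (hr : 0 < valL p L α) {φ : ℤ_[p] → ℤ_[p]}
    (hφ : GoodMap L φ) (hT : BddOp k α β T) : BddOp k α β fun f z => T f (φ z) :=
  (hT.comp hr goodWeight_one hφ).congr fun _ _ _ => (one_mul _).symm

/-- Gluing along the partition of `ℤ_p` into `pℤ_p` and the units. -/
lemma glue (hr : 0 < valL p L α) (c : L) (hS : BddOp k α β S) (hT : BddOp k α β T) :
    BddOp k α β fun f z => if ‖z‖ < 1 then c * S f (divP z)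
      else iotaInt p L z ^ (k - 2) * T f z.inv := by
  have hσ := goodWeight_one.ite (goodWeight_zero (p := p) (L := L))
  have hτ := goodWeight_zero.ite (goodWeight_affine_pow (p := p) (L := L) 1 0 (k - 2))
  refine (((hS.comp hr hσ goodMap_divP).const_mul hr c).add hr
    (hT.comp hr hτ goodMap_inv)).congr fun f _ z => ?_
  split_ifs <;> simp

lemma restrict (h : Hyps p L k α β) :
    BddOp k α β fun (f : ℚ_[p] → L) (z : ℤ_[p]) => f (z : ℚ_[p]) := by
  refine (glue h.2.2.1 1 mulP BddOp.ext2).congr fun f hf z => ?_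
  split_ifs with hz
  · rw [one_mul, ← PadicInt.coe_natCast, ← PadicInt.coe_mul, p_mul_divP hz]
  · have hz1 := norm_eq_one_of_not_lt hz
    have hinv := PadicInt.mul_inv hz1
    have hn : ‖z.inv‖ = 1 := by
      have := congrArg norm hinv
      simpa [hz1] using this
    have h0 : z.inv ≠ 0 := norm_ne_zero_iff.mp (by rw [hn]; simp)
    have hq : (z.inv : ℚ_[p])⁻¹ = z := by
      refine inv_eq_of_mul_eq_one_left ?_
      rw [← PadicInt.coe_mul, hinv, PadicInt.coe_one]
    have h0' : (z.inv : ℚ_[p]) ≠ 0 := fun e => h0 (Subtype.ext e)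
    rw [← homB_one_left hf, homB, if_neg h0', chi_of_norm_eq_one hn,
      one_div, hq, ← mul_assoc, ← mul_pow, ← map_mul, hinv, map_one, one_pow, one_mul]

end BddOp

end Banach

section Action

variable {p L} {k : ℕ} {α β : L}

lemma ne_zero_or_ne_zero {m : Matrix (Fin 2) (Fin 2) ℚ_[p]} (hm : det2 p m ≠ 0) {x y : ℚ_[p]}
    (hxy : x ≠ 0 ∨ y ≠ 0) : m 1 1 * x - m 0 1 * y ≠ 0 ∨ -(m 1 0) * x + m 0 0 * y ≠ 0 := by
  by_contra! h
  have h1 : det2 p m * x = 0 := by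
    rw [det2]; linear_combination m 0 0 * h.1 + m 0 1 * h.2
  have h2 : det2 p m * y = 0 := by
    rw [det2]; linear_combination m 1 0 * h.1 + m 1 1 * h.2
  rcases hxy with hx | hy
  · exact mul_ne_zero hm hx h1
  · exact mul_ne_zero hm hy h2

lemma det2_mul (m m' : Matrix (Fin 2) (Fin 2) ℚ_[p]) :
    det2 p (m * m') = det2 p m * det2 p m' := by
  simp only [det2, Matrix.mul_apply, Fin.sum_univ_two]
  ring

variable (k α β) in
/-- The matrix `m` acts on `B(α)` by a bounded operator, compatibly with values at infinity. -/
structure GoodMat (m : Matrix (Fin 2) (Fin 2) ℚ_[p]) : Prop where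
  det_ne_zero : det2 p m ≠ 0
  bounded : ∃ C : ℝ, 0 ≤ C ∧ ∀ f, MemB p L k α β f → MemB p L k α β (gAct p L k α β m f) ∧
    bNorm p L k α β (gAct p L k α β m f) ≤ C * bNorm p L k α β f
  ext2_zero : ∀ f, MemB p L k α β f → ext2 p L k α β (gAct p L k α β m f) 0 =
    α ^ (-(det2 p m).valuation) * homB L k α β f (m 1 1) (-(m 1 0))

lemma GoodMat.homB_gAct (h : Hyps p L k α β) {m : Matrix (Fin 2) (Fin 2) ℚ_[p]}
    (hm : GoodMat k α β m) {f : ℚ_[p] → L} (hf : MemB p L k α β f) {x y : ℚ_[p]}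
    (hxy : x ≠ 0 ∨ y ≠ 0) :
    homB L k α β (gAct p L k α β m f) x y = α ^ (-(det2 p m).valuation) *
      homB L k α β f (m 1 1 * x - m 0 1 * y) (-(m 1 0) * x + m 0 0 * y) := by
  by_cases hy : y = 0
  · have hx : x ≠ 0 := hxy.resolve_right (not_not.mpr hy)
    have hne := ne_zero_or_ne_zero hm.det_ne_zero (x := 1) (y := 0) (.inl one_ne_zero)
    have e1 : m 1 1 * x - m 0 1 * y = x * (m 1 1 * 1 - m 0 1 * 0) := by rw [hy]; ring
    have e2 : -(m 1 0) * x + m 0 0 * y = x * (-(m 1 0) * 1 + m 0 0 * 0) := by rw [hy]; ring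
    rw [e1, e2, homB_mul h f hx hne, homB, if_pos hy, hm.ext2_zero f hf]
    simp only [mul_one, mul_zero, sub_zero, add_zero]
    ring
  · have hne := ne_zero_or_ne_zero hm.det_ne_zero (x := x / y) (y := 1) (.inr one_ne_zero)
    have e1 : m 1 1 * x - m 0 1 * y = y * (m 1 1 * (x / y) - m 0 1 * 1) := by field_simp
    have e2 : -(m 1 0) * x + m 0 0 * y = y * (-(m 1 0) * (x / y) + m 0 0 * 1) := by field_simp
    rw [e1, e2, homB_mul h f hy hne, homB, if_neg hy, gAct_eq hm.det_ne_zero]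
    simp only [mul_one]
    ring

lemma zpow_neg_valuation_mul (h : Hyps p L k α β) {x y : ℚ_[p]} (hx : x ≠ 0) (hy : y ≠ 0) :
    α ^ (-(x * y).valuation) = α ^ (-x.valuation) * α ^ (-y.valuation) := by
  rw [Padic.valuation_mul hx hy, neg_add, zpow_add₀ (ne_zero_of_valL_pos h.2.2.1)]

lemma GoodMat.gAct_mul (h : Hyps p L k α β) {m m' : Matrix (Fin 2) (Fin 2) ℚ_[p]}
    (hm : det2 p m ≠ 0) (hm' : GoodMat k α β m') {f : ℚ_[p] → L} (hf : MemB p L k α β f) :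
    gAct p L k α β (m * m') f = gAct p L k α β m (gAct p L k α β m' f) := by
  funext z
  have hd := hm'.det_ne_zero
  have hne := ne_zero_or_ne_zero hm (x := z) (y := 1) (.inr one_ne_zero)
  simp only [mul_one] at hne
  rw [gAct_eq (by rw [det2_mul]; exact mul_ne_zero hm hd), gAct_eq hm, hm'.homB_gAct h hf hne,
    det2_mul, zpow_neg_valuation_mul h hm hd, mul_assoc]
  congr 3 <;> simp only [Matrix.mul_apply, Fin.sum_univ_two] <;> ring

lemma GoodMat.mul (h : Hyps p L k α β) {m m' : Matrix (Fin 2) (Fin 2) ℚ_[p]}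
    (hm : GoodMat k α β m) (hm' : GoodMat k α β m') : GoodMat k α β (m * m') := by
  have hd := hm.det_ne_zero
  have hd' := hm'.det_ne_zero
  obtain ⟨C, hC, hb⟩ := hm.bounded
  obtain ⟨D, hD, hb'⟩ := hm'.bounded
  refine ⟨by rw [det2_mul]; exact mul_ne_zero hd hd', ⟨C * D, by positivity, fun f hf => ?_⟩,
    fun f hf => ?_⟩
  · rw [GoodMat.gAct_mul h hd hm' hf]
    refine ⟨(hb _ (hb' f hf).1).1, (hb _ (hb' f hf).1).2.trans ?_⟩
    rw [mul_assoc]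
    exact mul_le_mul_of_nonneg_left (hb' f hf).2 hC
  · have hne := ne_zero_or_ne_zero hd (x := 1) (y := 0) (.inl one_ne_zero)
    simp only [mul_one, mul_zero, sub_zero, add_zero] at hne
    rw [GoodMat.gAct_mul h hd hm' hf, hm.ext2_zero _ (hb' f hf).1, hm'.homB_gAct h hf hne,
      det2_mul, zpow_neg_valuation_mul h hd hd', mul_assoc]
    congr 3 <;> simp only [Matrix.mul_apply, Fin.sum_univ_two] <;> ring

variable [IsUltrametricDist L] [CompleteSpace L]

lemma GoodMat.of_bddOp (h : Hyps p L k α β) {m : Matrix (Fin 2) (Fin 2) ℚ_[p]}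
    (hm : det2 p m ≠ 0)
    (hA : BddOp k α β fun f (z : ℤ_[p]) =>
      homB L k α β f (m 1 1 * (z : ℚ_[p]) - m 0 1) (-(m 1 0) * (z : ℚ_[p]) + m 0 0))
    (hA' : BddOp k α β fun f (z : ℤ_[p]) =>
      homB L k α β f (m 1 1 - m 0 1 * (z : ℚ_[p])) (-(m 1 0) + m 0 0 * (z : ℚ_[p]))) :
    GoodMat k α β m := by
  have hr := h.2.2.1
  set c := α ^ (-(det2 p m).valuation) with hc
  have h1 : BddOp k α β fun f (z : ℤ_[p]) =>
      gAct p L k α β m f ((p : ℚ_[p]) * (z : ℚ_[p])) := by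
    refine ((hA.comp_map hr (goodMap_affine (p : ℤ_[p]) 0)).const_mul hr c).congr fun f _ z => ?_
    rw [gAct_eq hm]
    simp [hc]
  have h2 : ∀ f, MemB p L k α β f → Ext2 p L k α β (gAct p L k α β m f) fun z : ℤ_[p] =>
      c * homB L k α β f (m 1 1 - m 0 1 * (z : ℚ_[p])) (-(m 1 0) + m 0 0 * (z : ℚ_[p])) := by
    obtain ⟨C, hC, hb⟩ := hA'.const_mul hr c
    refine fun f hf => ⟨(hb f hf).1, fun z hz => ?_⟩
    have hz' : (z : ℚ_[p]) ≠ 0 := fun e => hz (Subtype.ext e)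
    have hne := ne_zero_or_ne_zero hm (x := (z : ℚ_[p])⁻¹) (y := 1) (.inr one_ne_zero)
    simp only [mul_one] at hne
    have e1 : m 1 1 - m 0 1 * (z : ℚ_[p]) = z * (m 1 1 * (z : ℚ_[p])⁻¹ - m 0 1) := by
      field_simp
    have e2 : -(m 1 0) + m 0 0 * (z : ℚ_[p]) = z * (-(m 1 0) * (z : ℚ_[p])⁻¹ + m 0 0) := by
      field_simp
    simp only [e1, e2]
    rw [homB_mul h f hz' hne, gAct_eq hm, chi]
    ring
  have h3 : BddOp k α β fun f => ext2 p L k α β (gAct p L k α β m f) :=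
    (hA'.const_mul hr c).congr fun f hf z => by rw [(h2 f hf).ext2_eq h]
  refine ⟨hm, ?_, fun f hf => by rw [(h2 f hf).ext2_eq h]; simp [hc]⟩
  obtain ⟨C, hC, hb⟩ := h1
  obtain ⟨D, hD, hb'⟩ := h3
  refine ⟨max C D, le_max_of_le_left hC, fun f hf => ⟨⟨(hb f hf).1, _, h2 f hf⟩, max_le ?_ ?_⟩⟩
  · exact (hb f hf).2.trans (by gcongr; exacts [bNorm_nonneg f, le_max_left _ _])
  · exact (hb' f hf).2.trans (by gcongr; exacts [bNorm_nonneg f, le_max_right _ _])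

lemma goodMat_scalar (h : Hyps p L k α β) {s : ℚ_[p]} (hs : s ≠ 0) :
    GoodMat k α β !![s, 0; 0, s] := by
  refine .of_bddOp h (by simpa [det2] using hs)
    (((BddOp.restrict h).const_mul h.2.2.1 (chi L k α β s)).congr fun f _ z => ?_)
    ((BddOp.ext2.const_mul h.2.2.1 (chi L k α β s)).congr fun f hf z => ?_)
  · rw [← homB_one_right (k := k) (α := α) (β := β) f, ← homB_mul h f hs (.inr one_ne_zero)]
    simp
  · rw [← homB_one_left hf, ← homB_mul h f hs (.inl one_ne_zero)]
    simp

lemma goodMat_swap (h : Hyps p L k α β) : GoodMat k α β (p := p) !![0, 1; 1, 0] := by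
  have hs : (-1 : ℚ_[p]) ≠ 0 := by simp
  refine .of_bddOp h (by simp [det2])
    ((BddOp.ext2.const_mul h.2.2.1 (chi L k α β (-1 : ℚ_[p]))).congr fun f hf z => ?_)
    (((BddOp.restrict h).const_mul h.2.2.1 (chi L k α β (-1 : ℚ_[p]))).congr fun f _ z => ?_)
  · rw [← homB_one_left hf, ← homB_mul h f hs (.inl one_ne_zero)]
    simp
  · rw [← homB_one_right (k := k) (α := α) (β := β) f, ← homB_mul h f hs (.inr one_ne_zero)]
    simp

lemma goodMat_diag_unit (h : Hyps p L k α β) (u : ℤ_[p]ˣ) :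
    GoodMat k α β !![1, 0; 0, ((u : ℤ_[p]) : ℚ_[p])] := by
  have hu : ((u : ℤ_[p]) : ℚ_[p]) ≠ 0 := fun e => u.ne_zero (Subtype.ext e)
  refine .of_bddOp h (by simp [det2])
    (((BddOp.restrict h).comp_map h.2.2.1 (goodMap_affine (u : ℤ_[p]) 0)).congr fun f _ z => ?_)
    (((BddOp.ext2.comp_map h.2.2.1 (goodMap_affine ((u⁻¹ : ℤ_[p]ˣ) : ℤ_[p]) 0)).const_mul h.2.2.1
      (chi L k α β ((u : ℤ_[p]) : ℚ_[p]))).congr fun f hf z => ?_)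
  · simp [homB_one_right]
  · rw [← homB_one_left hf, ← homB_mul h f hu (.inl one_ne_zero), ← PadicInt.coe_mul]
    simp

lemma goodMat_diag_p (h : Hyps p L k α β) : GoodMat k α β !![1, 0; 0, (p : ℚ_[p])] := by
  have hp : (p : ℚ_[p]) ≠ 0 := mod_cast (Fact.out : p.Prime).ne_zero
  refine .of_bddOp h (by simpa [det2] using hp)
    (BddOp.mulP.congr fun f _ z => by simp [homB_one_right])
    ((BddOp.glue h.2.2.1 (chi L k α β (p : ℚ_[p])) BddOp.ext2 BddOp.mulP).congr fun f hf z => ?_)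
  split_ifs with hz
  · rw [← homB_one_left hf, ← homB_mul h f hp (.inl one_ne_zero), ← PadicInt.coe_natCast,
      ← PadicInt.coe_mul, p_mul_divP hz]
    simp
  · have hz1 := norm_eq_one_of_not_lt hz
    have h0 : (z : ℚ_[p]) ≠ 0 := fun e => by
      have : z = 0 := Subtype.ext e
      simp [this] at hz1
    have hq : (z.inv : ℚ_[p]) = (z : ℚ_[p])⁻¹ := by
      refine eq_inv_of_mul_eq_one_right ?_
      rw [← PadicInt.coe_mul, PadicInt.mul_inv hz1, PadicInt.coe_one]
    simp [homB, h0, chi_of_norm_eq_one hz1, hq, div_eq_mul_inv]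

lemma goodMat_unipotent_p (h : Hyps p L k α β) : GoodMat k α β !![1, (p : ℚ_[p]); 0, 1] := by
  refine .of_bddOp h (by simp [det2])
    (((BddOp.restrict h).comp_map h.2.2.1 (goodMap_affine 1 (-p : ℤ_[p]))).congr fun f _ z => ?_)
    ((BddOp.ext2.comp h.2.2.1 (goodWeight_affine_pow (-p : ℤ_[p]) 1 (k - 2)) goodMap_moebP).congr
      fun f hf z => ?_)
  · simp [homB_one_right, sub_eq_add_neg]
  · have hw := norm_one_sub_p_mul z
    set w := 1 - p * z with hwdef
    have h0 : (w : ℚ_[p]) ≠ 0 := fun e => by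
      have : w = 0 := Subtype.ext e
      simp [this] at hw
    have e : w * moebP z = z := by
      rw [moebP, mul_left_comm, ← hwdef, PadicInt.mul_inv hw, mul_one]
    rw [show -(p : ℤ_[p]) * z + 1 = w by rw [hwdef]; ring,
      ← chi_of_norm_eq_one (α := α) (β := β) hw, ← homB_one_left hf,
      ← homB_mul h f h0 (.inl one_ne_zero), ← PadicInt.coe_mul, e, hwdef]
    simp

end Action

section Generation

variable {p L} {k : ℕ} {α β : L}

lemma gAct_one (f : ℚ_[p] → L) : gAct p L k α β 1 f = f := by
  funext z
  rw [gAct_eq (by simp [det2])]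
  simp [det2, homB_one_right]

variable [IsUltrametricDist L] [CompleteSpace L]

lemma homB_add (h : Hyps p L k α β) {f g : ℚ_[p] → L} (hf : MemB p L k α β f)
    (hg : MemB p L k α β g) (x y : ℚ_[p]) :
    homB L k α β (f + g) x y = homB L k α β f x y + homB L k α β g x y := by
  have he : Ext2 p L k α β (f + g) fun z => ext2 p L k α β f z + ext2 p L k α β g z :=
    ⟨hf.ext2_spec.1.add hg.ext2_spec.1, fun z hz => by
      beta_reduce
      rw [hf.ext2_spec.2 z hz, hg.ext2_spec.2 z hz, Pi.add_apply, mul_add]⟩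
  simp only [homB, he.ext2_eq h, Pi.add_apply]
  split_ifs <;> ring

lemma homB_smul (h : Hyps p L k α β) (c : L) {f : ℚ_[p] → L} (hf : MemB p L k α β f)
    (x y : ℚ_[p]) : homB L k α β (c • f) x y = c * homB L k α β f x y := by
  have he : Ext2 p L k α β (c • f) fun z => c * ext2 p L k α β f z :=
    ⟨hf.ext2_spec.1.const_mul c, fun z hz => by
      beta_reduce
      rw [hf.ext2_spec.2 z hz, Pi.smul_apply, smul_eq_mul]; ring⟩
  simp only [homB, he.ext2_eq h, Pi.smul_apply, smul_eq_mul]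
  split_ifs <;> ring

lemma goodMat_diag_zpow_p (h : Hyps p L k α β) (n : ℤ) :
    GoodMat k α β !![1, 0; 0, (p : ℚ_[p]) ^ n] := by
  have hp : (p : ℚ_[p]) ≠ 0 := mod_cast (Fact.out : p.Prime).ne_zero
  have hinv : GoodMat k α β !![1, 0; 0, (p : ℚ_[p])⁻¹] := by
    have := (goodMat_scalar h (inv_ne_zero hp)).mul h
      ((goodMat_swap h).mul h ((goodMat_diag_p h).mul h (goodMat_swap h)))
    simpa [hp] using this
  induction n with
  | zero => simpa using goodMat_scalar h (one_ne_zero (α := ℚ_[p]))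
  | succ n ih => simpa [zpow_add_one₀ hp] using ih.mul h (goodMat_diag_p h)
  | pred n ih => simpa [zpow_sub_one₀ hp] using ih.mul h hinv

lemma goodMat_diag (h : Hyps p L k α β) {a d : ℚ_[p]} (ha : a ≠ 0) (hd : d ≠ 0) :
    GoodMat k α β !![a, 0; 0, d] := by
  have key : ∀ x : ℚ_[p], x ≠ 0 → GoodMat k α β !![1, 0; 0, x] := by
    intro x hx
    have hp : (p : ℚ_[p]) ≠ 0 := mod_cast (Fact.out : p.Prime).ne_zero
    have hn : ‖x * (p : ℚ_[p]) ^ (-x.valuation)‖ = 1 := by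
      rw [norm_mul, norm_zpow, Padic.norm_p, Padic.norm_eq_zpow_neg_valuation hx, inv_zpow',
        neg_neg, ← zpow_add₀ (mod_cast (Fact.out : p.Prime).ne_zero), neg_add_cancel, zpow_zero]
    have := (goodMat_diag_unit h (PadicInt.mkUnits hn)).mul h (goodMat_diag_zpow_p h x.valuation)
    simpa [mul_assoc, ← zpow_add₀ hp, ← zpow_neg] using this
  have := (goodMat_scalar h ha).mul h (key (d / a) (div_ne_zero hd ha))
  simpa [mul_div_cancel₀ _ ha] using this

lemma goodMat_unipotent (h : Hyps p L k α β) (t : ℚ_[p]) : GoodMat k α β !![1, t; 0, 1] := by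
  by_cases ht : t = 0
  · simpa [ht] using goodMat_scalar h (one_ne_zero (α := ℚ_[p]))
  · have hp : (p : ℚ_[p]) ≠ 0 := mod_cast (Fact.out : p.Prime).ne_zero
    have := (goodMat_diag h (div_ne_zero ht hp) one_ne_zero).mul h
      ((goodMat_unipotent_p h).mul h (goodMat_diag h (div_ne_zero hp ht) one_ne_zero))
    simpa [hp, ht] using this

lemma goodMat_of_det_ne_zero (h : Hyps p L k α β) (m : Matrix (Fin 2) (Fin 2) ℚ_[p])
    (hm : det2 p m ≠ 0) : GoodMat k α β m := by
  have upper : ∀ a b d : ℚ_[p], a ≠ 0 → d ≠ 0 → GoodMat k α β !![a, b; 0, d] := by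
    intro a b d ha hd
    simpa [hd] using (goodMat_unipotent h (b / d)).mul h (goodMat_diag h ha hd)
  by_cases hc : m 1 0 = 0
  · have hm' := hm
    rw [det2, hc, mul_zero, sub_zero] at hm'
    have := upper _ (m 0 1) _ (left_ne_zero_of_mul hm') (right_ne_zero_of_mul hm')
    rwa [Matrix.eta_fin_two m, hc]
  · have := (goodMat_unipotent h (m 0 0 / m 1 0)).mul h ((goodMat_swap h).mul h
      (upper (m 1 0) (m 1 1) (-(det2 p m / m 1 0)) hc (neg_ne_zero.mpr (div_ne_zero hm hc))))
    rw [Matrix.eta_fin_two m]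
    convert this using 1
    ext i j
    fin_cases i <;> fin_cases j <;> simp [det2] <;> field_simp
    ring

end Generation

/-- For every `g ∈ GL₂(ℚ_p)` and `f ∈ B(α)`, `g·f ∈ B(α)` and `f ↦ g·f` is a
continuous linear automorphism of `B(α)`; the formula defines an action of
`GL₂(ℚ_p)` on `B(α)` by continuous automorphisms. -/
theorem statement5 (p : ℕ) [Fact p.Prime] (L : Type) [NontriviallyNormedField L]
    [NormedAlgebra ℚ_[p] L] [FiniteDimensional ℚ_[p] L] [IsUltrametricDist L]
    (k : ℕ) (α β : L) (h : Hyps p L k α β) :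
    (∀ m : Matrix (Fin 2) (Fin 2) ℚ_[p], det2 p m ≠ 0 →
      (∀ f : ℚ_[p] → L, MemB p L k α β f → MemB p L k α β (gAct p L k α β m f)) ∧
      (∀ f g : ℚ_[p] → L, MemB p L k α β f → MemB p L k α β g →
        gAct p L k α β m (f + g) = gAct p L k α β m f + gAct p L k α β m g) ∧
      (∀ (c : L) (f : ℚ_[p] → L), MemB p L k α β f →
        gAct p L k α β m (c • f) = c • gAct p L k α β m f) ∧
      (∃ C : ℝ, 0 < C ∧ ∀ f : ℚ_[p] → L, MemB p L k α β f →
        bNorm p L k α β (gAct p L k α β m f) ≤ C * bNorm p L k α β f) ∧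
      (∀ f g : ℚ_[p] → L, MemB p L k α β f → MemB p L k α β g →
        gAct p L k α β m f = gAct p L k α β m g → f = g) ∧
      (∀ F : ℚ_[p] → L, MemB p L k α β F →
        ∃ f : ℚ_[p] → L, MemB p L k α β f ∧ gAct p L k α β m f = F)) ∧
    (∀ f : ℚ_[p] → L, MemB p L k α β f → gAct p L k α β 1 f = f) ∧
    (∀ m m' : Matrix (Fin 2) (Fin 2) ℚ_[p], det2 p m ≠ 0 → det2 p m' ≠ 0 →
      ∀ f : ℚ_[p] → L, MemB p L k α β f →
        gAct p L k α β (m * m') f = gAct p L k α β m (gAct p L k α β m' f)) := by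
  have : CompleteSpace L := FiniteDimensional.complete ℚ_[p] L
  have good := goodMat_of_det_ne_zero h
  refine ⟨fun m hm => ?_, fun f _ => gAct_one f,
    fun m m' hm hm' f hf => GoodMat.gAct_mul h hm (good m' hm') hf⟩
  obtain ⟨C, hC, hb⟩ := (good m hm).bounded
  have hu : IsUnit m.det := by
    rw [Matrix.det_fin_two]; exact isUnit_iff_ne_zero.mpr hm
  have hmm : m⁻¹ * m = 1 := Matrix.nonsing_inv_mul m hu
  have hm' : det2 p m⁻¹ ≠ 0 := by
    refine left_ne_zero_of_mul (b := det2 p m) ?_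
    rw [← det2_mul, hmm]
    simp [det2]
  have hleft : ∀ f, MemB p L k α β f → gAct p L k α β m⁻¹ (gAct p L k α β m f) = f := by
    intro f hf
    rw [← GoodMat.gAct_mul h hm' (good m hm) hf, hmm, gAct_one]
  refine ⟨fun f hf => (hb f hf).1, fun f g hf hg => ?_, fun c f hf => ?_,
    ⟨C + 1, by positivity, fun f hf => (hb f hf).2.trans ?_⟩, fun f g hf hg e => ?_,
    fun F hF => ⟨gAct p L k α β m⁻¹ F, ?_, ?_⟩⟩
  · funext z
    simp only [Pi.add_apply, gAct_eq hm, homB_add h hf hg, mul_add]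
  · funext z
    simp only [Pi.smul_apply, smul_eq_mul, gAct_eq hm, homB_smul h c hf, mul_left_comm]
  · exact mul_le_mul_of_nonneg_right (by linarith) (bNorm_nonneg f)
  · rw [← hleft f hf, e, hleft g hg]
  · obtain ⟨D, hD, hb'⟩ := (good _ hm').bounded
    exact (hb' F hF).1
  · rw [← GoodMat.gAct_mul h hm (good _ hm') hF, Matrix.mul_nonsing_inv m hu, gAct_one]

end Paper

end
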